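/- There is an absolute constant C_5 with the following property: if f : F_2^n → C is a function with |f(x)| ≤ 1 for all x and ‖f‖_{U^3(F_2^n)} ≥ 1/K, then there exists a polynomial P : F_2^n → F_2 of degree at most 2 such that |2^{−n} · Σ_{x ∈ F_2^n} f(x)·(−1)^{P(x)}| ≥ c·K^{−C_5} for some absolute constant c > 0. -/

import Mathlib

open scoped ComplexConjugate BigOperators

noncomputable section

/-- The eighth power of the Gowers `U³` norm of `f : G → ℂ`:
`E_{x,h₁,h₂,h₃} ∏_{ω ∈ {0,1}³} 𝒞^{|ω|} f(x + ω·h)`. -/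
def u3Pow8 {G : Type*} [Fintype G] [AddCommGroup G] (f : G → ℂ) : ℂ :=
  ((Fintype.card G : ℂ))⁻¹ ^ 4 *
    ∑ x : G, ∑ h₁ : G, ∑ h₂ : G, ∑ h₃ : G,
      f x * conj (f (x + h₁)) * conj (f (x + h₂)) * conj (f (x + h₃)) *
        f (x + h₁ + h₂) * f (x + h₁ + h₃) * f (x + h₂ + h₃) *
        conj (f (x + h₁ + h₂ + h₃))

/-- The Gowers `U³` norm of `f : G → ℂ`. -/
def u3Norm {G : Type*} [Fintype G] [AddCommGroup G] (f : G → ℂ) : ℝ :=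
  (u3Pow8 f).re ^ ((1 : ℝ) / 8)

/-- A function `P : F_2^n → F_2` is a polynomial of degree at most 2 in the coordinates. -/
def IsQuadratic {n : ℕ} (P : (Fin n → ZMod 2) → ZMod 2) : Prop :=
  ∃ (c₀ : ZMod 2) (a : Fin n → ZMod 2) (b : Fin n → Fin n → ZMod 2),
    ∀ x, P x = c₀ + (∑ i, a i * x i) + ∑ i, ∑ j, b i j * x i * x j

namespace U3I

set_option linter.unusedSectionVars false

section entropy
open Finset Real
open scoped Classical

variable {Ω Ω' α β γ : Type} [Fintype Ω] [Fintype Ω'] [Fintype α] [Fintype β] [Fintype γ]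

/-- law of `X` under the weight `w` -/
def P (w : Ω → ℝ) (X : Ω → α) (a : α) : ℝ := ∑ ω, if X ω = a then w ω else 0
/-- unnormalised entropy of a measure -/
def S (μ : α → ℝ) : ℝ := ∑ a, negMulLog (μ a)
/-- entropy of a random variable -/
def En (w : Ω → ℝ) (X : Ω → α) : ℝ := S (P w X)

lemma P_nonneg {w : Ω → ℝ} (hw : ∀ ω, 0 ≤ w ω) (X : Ω → α) (a : α) : 0 ≤ P w X a :=
  sum_nonneg fun ω _ => by split_ifs <;> simp [hw]

lemma sum_P_mul (w : Ω → ℝ) (X : Ω → α) (F : α → ℝ) :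
    ∑ a, P w X a * F a = ∑ ω, w ω * F (X ω) := by
  simp only [P, sum_mul]
  rw [sum_comm]
  refine sum_congr rfl fun ω _ => ?_
  simp [ite_mul]

lemma sum_P (w : Ω → ℝ) (X : Ω → α) : ∑ a, P w X a = ∑ ω, w ω := by
  simpa using sum_P_mul w X (fun _ => 1)

lemma En_eq (w : Ω → ℝ) (X : Ω → α) : En w X = -∑ ω, w ω * log (P w X (X ω)) := by
  rw [← sum_P_mul w X (fun a => log (P w X a)), En, S, ← sum_neg_distrib]
  simp [negMulLog]

lemma P_comp (w : Ω → ℝ) (X : Ω → α) (f : α → β) :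
    P w (fun ω => f (X ω)) = P (P w X) f := by
  funext b
  have := sum_P_mul w X (fun a => if f a = b then 1 else 0)
  simp only [mul_ite, mul_one, mul_zero] at this
  simp only [P] at this ⊢
  exact this.symm

lemma le_P {w : Ω → ℝ} (hw : ∀ ω, 0 ≤ w ω) (X : Ω → α) (ω : Ω) : w ω ≤ P w X (X ω) := by
  have := single_le_sum (f := fun ω' => if X ω' = X ω then w ω' else 0) (s := univ)
    (fun ω' _ => by split_ifs <;> simp [hw]) (mem_univ ω)
  simpa [P] using this

lemma En_le_of {w : Ω → ℝ} (hw : ∀ ω, 0 ≤ w ω) (X : Ω → α) (Y : Ω → β)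
    (h : ∀ ω ω', w ω ≠ 0 → w ω' ≠ 0 → Y ω = Y ω' → X ω = X ω') : En w X ≤ En w Y := by
  rw [En_eq, En_eq, neg_le_neg_iff]
  refine sum_le_sum fun ω _ => ?_
  by_cases h0 : w ω = 0
  · simp [h0]
  have hp : 0 < w ω := lt_of_le_of_ne (hw ω) (Ne.symm h0)
  refine mul_le_mul_of_nonneg_left (log_le_log (hp.trans_le (le_P hw Y ω)) ?_) hp.le
  refine sum_le_sum fun ω' _ => ?_
  by_cases h1 : w ω' = 0
  · simp [h1]
  by_cases h2 : Y ω' = Y ω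
  · rw [if_pos h2, if_pos (h _ _ h1 h0 h2)]
  · rw [if_neg h2]; split_ifs <;> simp [hw]

lemma En_eq_of {w : Ω → ℝ} (hw : ∀ ω, 0 ≤ w ω) (X : Ω → α) (Y : Ω → β)
    (h : ∀ ω ω', w ω ≠ 0 → w ω' ≠ 0 → (X ω = X ω' ↔ Y ω = Y ω')) : En w X = En w Y :=
  le_antisymm (En_le_of hw X Y fun a b ha hb => (h a b ha hb).2)
    (En_le_of hw Y X fun a b ha hb => (h a b ha hb).1)

lemma P_marg (w : Ω → ℝ) (X : Ω → α) (Z : Ω → γ) (c : γ) :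
    ∑ a, P w (fun ω => (X ω, Z ω)) (a, c) = P w Z c := by
  simp only [P]
  rw [sum_comm]
  refine sum_congr rfl fun ω _ => ?_
  by_cases h : Z ω = c <;> simp [h]

lemma submod {w : Ω → ℝ} (hw : ∀ ω, 0 ≤ w ω) (X : Ω → α) (Y : Ω → β) (Z : Ω → γ) :
    En w (fun ω => (X ω, Y ω, Z ω)) + En w Z ≤
      En w (fun ω => (X ω, Z ω)) + En w (fun ω => (Y ω, Z ω)) := by
  set r := P w (fun ω => (X ω, Y ω, Z ω)) with hr
  set u := P w (fun ω => (X ω, Z ω)) with hu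
  set v := P w (fun ω => (Y ω, Z ω)) with hv
  set m := P w Z with hm
  have hr0 : ∀ t, 0 ≤ r t := P_nonneg hw _
  have hu0 : ∀ t, 0 ≤ u t := P_nonneg hw _
  have hv0 : ∀ t, 0 ≤ v t := P_nonneg hw _
  have hm0 : ∀ t, 0 ≤ m t := P_nonneg hw _
  have key : ∑ ω, w ω * (u (X ω, Z ω) * v (Y ω, Z ω) / (r (X ω, Y ω, Z ω) * m (Z ω))) ≤ ∑ ω, w ω := by
    have h1 := sum_P_mul w (fun ω => (X ω, Y ω, Z ω))
      (fun t => u (t.1, t.2.2) * v (t.2.1, t.2.2) / (r t * m t.2.2))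
    rw [← h1, ← hr]
    calc ∑ t, r t * (u (t.1, t.2.2) * v (t.2.1, t.2.2) / (r t * m t.2.2))
        ≤ ∑ t : α × β × γ, u (t.1, t.2.2) * v (t.2.1, t.2.2) / m t.2.2 := by
          refine sum_le_sum fun t _ => ?_
          by_cases h : r t = 0
          · rw [h, zero_mul]
            exact div_nonneg (mul_nonneg (hu0 _) (hv0 _)) (hm0 _)
          · rw [mul_div_assoc', mul_div_mul_left _ _ h]
      _ = ∑ c, (∑ a, u (a, c)) * (∑ b, v (b, c)) / m c := by
          rw [Fintype.sum_prod_type]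
          simp_rw [Fintype.sum_prod_type]
          simp_rw [sum_mul_sum, sum_div]
          rw [sum_congr rfl fun _ _ => sum_comm, sum_comm]
      _ = ∑ c, m c * m c / m c := by
          refine sum_congr rfl fun c _ => ?_
          rw [hu, hv, P_marg, P_marg]
      _ ≤ ∑ c, m c := sum_le_sum fun c _ => by
          by_cases h : m c = 0
          · simp [h]
          · rw [mul_div_assoc, div_self h, mul_one]
      _ = ∑ ω, w ω := sum_P w Z
  have pw : ∀ ω, w ω * log (u (X ω, Z ω)) + w ω * log (v (Y ω, Z ω))
      - w ω * log (r (X ω, Y ω, Z ω)) - w ω * log (m (Z ω)) ≤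
      w ω * (u (X ω, Z ω) * v (Y ω, Z ω) / (r (X ω, Y ω, Z ω) * m (Z ω))) - w ω := by
    intro ω
    by_cases h0 : w ω = 0
    · simp [h0]
    have hp : 0 < w ω := lt_of_le_of_ne (hw ω) (Ne.symm h0)
    have a1 : 0 < u (X ω, Z ω) := hp.trans_le (le_P hw (fun ω => (X ω, Z ω)) ω)
    have a2 : 0 < v (Y ω, Z ω) := hp.trans_le (le_P hw (fun ω => (Y ω, Z ω)) ω)
    have a3 : 0 < r (X ω, Y ω, Z ω) := hp.trans_le (le_P hw (fun ω => (X ω, Y ω, Z ω)) ω)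
    have a4 : 0 < m (Z ω) := hp.trans_le (le_P hw Z ω)
    have := log_le_sub_one_of_pos (div_pos (mul_pos a1 a2) (mul_pos a3 a4))
    rw [log_div (by positivity) (by positivity), log_mul a1.ne' a2.ne', log_mul a3.ne' a4.ne'] at this
    nlinarith
  have := sum_le_sum fun ω (_ : ω ∈ univ) => pw ω
  simp only [sum_sub_distrib, sum_add_distrib] at this
  rw [En_eq, En_eq, En_eq, En_eq, ← hr, ← hu, ← hv, ← hm]
  linarith

lemma En_const {w : Ω → ℝ} : En w (fun _ => ()) = negMulLog (∑ ω, w ω) := by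
  simp [En, S, P]

/-- subadditivity, unnormalised -/
lemma En_pair_le {w : Ω → ℝ} (hw : ∀ ω, 0 ≤ w ω) (X : Ω → α) (Y : Ω → β) :
    En w (fun ω => (X ω, Y ω)) + negMulLog (∑ ω, w ω) ≤ En w X + En w Y := by
  have h := submod hw X Y (fun _ => ())
  rw [En_const] at h
  rw [En_eq_of hw (fun ω => (X ω, Y ω)) (fun ω => (X ω, Y ω, ())) (by simp),
    En_eq_of hw X (fun ω => (X ω, ())) (by simp), En_eq_of hw Y (fun ω => (Y ω, ())) (by simp)]
  exact h

/-- product weight -/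
def pr (μ : α → ℝ) (ν : β → ℝ) (t : α × β) : ℝ := μ t.1 * ν t.2

lemma pr_nonneg {μ : α → ℝ} {ν : β → ℝ} (h : ∀ a, 0 ≤ μ a) (h' : ∀ a, 0 ≤ ν a) (t) :
    0 ≤ pr μ ν t := mul_nonneg (h _) (h' _)

lemma sum_pr (μ : α → ℝ) (ν : β → ℝ) : ∑ t, pr μ ν t = (∑ a, μ a) * ∑ b, ν b := by
  simp [pr, Fintype.sum_prod_type, sum_mul_sum]

lemma pr_P (w : Ω → ℝ) (w' : Ω' → ℝ) (f : Ω → α) (g : Ω' → β) :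
    pr (P w f) (P w' g) = P (pr w w') (fun ω => (f ω.1, g ω.2)) := by
  funext ⟨a, b⟩
  simp only [pr, P, sum_mul_sum, Fintype.sum_prod_type]
  refine sum_congr rfl fun ω _ => sum_congr rfl fun ω' _ => ?_
  by_cases h : f ω = a <;> by_cases h' : g ω' = b <;> simp [h, h']

lemma S_pr (μ : α → ℝ) (ν : β → ℝ) :
    S (pr μ ν) = (∑ b, ν b) * S μ + (∑ a, μ a) * S ν := by
  simp only [S, pr, Fintype.sum_prod_type, negMulLog_mul, sum_add_distrib, sum_mul_sum]
  rw [sum_comm]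

lemma En_pr (w : Ω → ℝ) (w' : Ω' → ℝ) (hw : ∑ ω, w ω = 1) (hw' : ∑ ω, w' ω = 1)
    (f : Ω → α) (g : Ω' → β) :
    En (pr w w') (fun ω => (f ω.1, g ω.2)) = En w f + En w' g := by
  rw [En, ← pr_P, S_pr, sum_P, sum_P, hw, hw', one_mul, one_mul]; rfl

lemma P_fst (w : Ω → ℝ) (w' : Ω' → ℝ) (hw' : ∑ ω, w' ω = 1) (f : Ω → α) :
    P (pr w w') (fun ω => f ω.1) = P w f := by
  funext a
  simp only [P, pr, Fintype.sum_prod_type]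
  refine sum_congr rfl fun ω _ => ?_
  by_cases h : f ω = a <;> simp [h, ← mul_sum, hw']

lemma P_snd (w : Ω → ℝ) (w' : Ω' → ℝ) (hw : ∑ ω, w ω = 1) (f : Ω' → α) :
    P (pr w w') (fun ω => f ω.2) = P w' f := by
  funext a
  simp only [P, pr, Fintype.sum_prod_type]
  rw [sum_comm]
  refine sum_congr rfl fun ω _ => ?_
  by_cases h : f ω = a <;> simp [h, ← sum_mul, hw]

lemma P_reindex (e : Ω ≃ Ω') (w : Ω' → ℝ) (X : Ω' → α) :
    P (fun ω => w (e ω)) (fun ω => X (e ω)) = P w X := by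
  funext a
  exact e.sum_comp (fun ω => if X ω = a then w ω else 0)

lemma P_id (w : Ω → ℝ) : P w (fun ω => ω) = w := by
  funext a; simp [P]

/-- homogeneous entropy -/
def ent (μ : α → ℝ) : ℝ := S μ - negMulLog (∑ a, μ a)

lemma ent_prob {μ : α → ℝ} (h : ∑ a, μ a = 1) : ent μ = S μ := by simp [ent, h]

lemma ent_smul (c : ℝ) (μ : α → ℝ) : ent (fun a => c * μ a) = c * ent μ := by
  simp only [ent, S, negMulLog_mul, ← mul_sum, sum_add_distrib, ← sum_mul]
  ring

/-- slice of `X` at `Z = z` -/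
def sl (w : Ω → ℝ) (X : Ω → α) (Z : Ω → γ) (z : γ) (x : α) : ℝ := P w (fun ω => (X ω, Z ω)) (x, z)

lemma sl_nonneg {w : Ω → ℝ} (hw : ∀ ω, 0 ≤ w ω) (X : Ω → α) (Z : Ω → γ) (z x) :
  0 ≤ sl w X Z z x := P_nonneg hw _ _

lemma sum_sl (w : Ω → ℝ) (X : Ω → α) (Z : Ω → γ) (z : γ) : ∑ x, sl w X Z z x = P w Z z :=
  P_marg w X Z z

lemma sum_ent_sl (w : Ω → ℝ) (X : Ω → α) (Z : Ω → γ) :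
    ∑ z, ent (sl w X Z z) = En w (fun ω => (X ω, Z ω)) - En w Z := by
  simp only [ent, sum_sl, sum_sub_distrib]
  congr 1
  simp only [S, En, sl, Fintype.sum_prod_type]
  rw [sum_comm]

lemma P_sl (w : Ω → ℝ) (Y : Ω → α) (Z : Ω → γ) (z : γ) (f : α → β) :
    P (sl w Y Z z) f = sl w (fun ω => f (Y ω)) Z z := by
  funext b
  have h := congrFun (P_comp w (fun ω => (Y ω, Z ω)) (fun t => (f t.1, t.2))) (b, z)
  rw [sl, h, P, P, Fintype.sum_prod_type]
  refine sum_congr rfl fun a _ => ?_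
  by_cases h : f a = b <;> simp [h, sl]

lemma sum_En_sl (w : Ω → ℝ) (Y : Ω → α) (Z : Ω → γ) (f : α → β) :
    ∑ z, En (sl w Y Z z) f = En w (fun ω => (f (Y ω), Z ω)) := by
  simp only [En, P_sl]
  simp only [S, sl, Fintype.sum_prod_type]
  rw [sum_comm]

end entropy
end U3I

namespace U3I
set_option linter.unusedSectionVars false

section grp
open Finset Real
open scoped Classical

variable {Ω Ω' α β γ γ' : Type} [Fintype Ω] [Fintype Ω'] [Fintype α] [Fintype β] [Fintype γ]
  [Fintype γ']
variable {G : Type} [Fintype G] [AddCommGroup G]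

/-- convolution -/
def conv (μ ν : G → ℝ) : G → ℝ := P (pr μ ν) (fun t => t.1 + t.2)

lemma sum_conv (μ ν : G → ℝ) : ∑ g, conv μ ν g = (∑ g, μ g) * ∑ g, ν g := by
  rw [conv, sum_P, sum_pr]

lemma conv_nonneg {μ ν : G → ℝ} (h : ∀ g, 0 ≤ μ g) (h' : ∀ g, 0 ≤ ν g) (g) : 0 ≤ conv μ ν g :=
  P_nonneg (pr_nonneg h h') _ _

lemma conv_smul (a b : ℝ) (μ ν : G → ℝ) :
    conv (fun g => a * μ g) (fun g => b * ν g) = fun g => a * b * conv μ ν g := by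
  funext g
  simp only [conv, P, pr, mul_sum]
  refine sum_congr rfl fun t _ => ?_
  split_ifs <;> ring

lemma conv_P (w : Ω → ℝ) (w' : Ω' → ℝ) (f : Ω → G) (g : Ω' → G) :
    conv (P w f) (P w' g) = P (pr w w') (fun ω => f ω.1 + g ω.2) := by
  rw [conv, pr_P, ← P_comp]

lemma conv_P_left (w : Ω → ℝ) (ν : G → ℝ) (f : Ω → G) :
    conv (P w f) ν = P (pr w ν) (fun ω => f ω.1 + ω.2) := by
  conv_lhs => rw [← P_id ν]
  rw [conv_P]

lemma conv_P_right (w : Ω → ℝ) (ν : G → ℝ) (f : Ω → G) :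
    conv ν (P w f) = P (pr ν w) (fun ω => ω.1 + f ω.2) := by
  conv_lhs => rw [← P_id ν]
  rw [conv_P]

lemma conv_comm (μ ν : G → ℝ) : conv μ ν = conv ν μ := by
  rw [conv, conv, ← P_reindex (Equiv.prodComm G G)]
  congr 1
  · funext t; simp [pr, mul_comm]
  · funext t; simp [add_comm]

/-- homogeneous Ruzsa distance -/
def D (μ ν : G → ℝ) : ℝ :=
  ent (conv μ ν) - (1/2) * (∑ g, ν g) * ent μ - (1/2) * (∑ g, μ g) * ent ν

lemma D_smul (a b : ℝ) (μ ν : G → ℝ) :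
    D (fun g => a * μ g) (fun g => b * ν g) = a * b * D μ ν := by
  simp only [D, conv_smul, ent_smul, ← mul_sum]; ring

/-- probability -/
def Pr (μ : α → ℝ) : Prop := (∀ a, 0 ≤ μ a) ∧ ∑ a, μ a = 1

lemma Pr.conv {μ ν : G → ℝ} (h : Pr μ) (h' : Pr ν) : Pr (conv μ ν) :=
  ⟨conv_nonneg h.1 h'.1, by rw [sum_conv, h.2, h'.2, one_mul]⟩

lemma Pr.pr {μ : α → ℝ} {ν : β → ℝ} (h : Pr μ) (h' : Pr ν) : Pr (pr μ ν) :=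
  ⟨pr_nonneg h.1 h'.1, by rw [sum_pr, h.2, h'.2, one_mul]⟩

lemma Pr.P {w : Ω → ℝ} (h : Pr w) (X : Ω → α) : Pr (P w X) :=
  ⟨P_nonneg h.1 _, by rw [sum_P, h.2]⟩

lemma D_prob {μ ν : G → ℝ} (h : Pr μ) (h' : Pr ν) :
    D μ ν = S (U3I.conv μ ν) - (1/2) * S μ - (1/2) * S ν := by
  rw [D, ent_prob h.2, ent_prob h'.2, ent_prob (h.conv h').2, h.2, h'.2]; ring

lemma P_swap (p : α → ℝ) (q : β → ℝ) (r : γ → ℝ) (X : (α × β) × γ → Ω) :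
    P (pr (pr p q) r) X = P (pr (pr q p) r) (fun ω => X ((ω.1.2, ω.1.1), ω.2)) := by
  rw [← P_reindex ((Equiv.prodComm α β).prodCongr (Equiv.refl γ))]
  congr 1
  funext t; simp [pr, mul_comm]

lemma P_assoc (p : α → ℝ) (q : β → ℝ) (r : γ → ℝ) (X : (α × β) × γ → Ω) :
    P (pr (pr p q) r) X = P (pr p (pr q r)) (fun ω => X ((ω.1, ω.2.1), ω.2.2)) := by
  rw [← P_reindex (Equiv.prodAssoc α β γ)]
  congr 1
  funext t; simp [pr]; ring

lemma P_comm4 (p : α → ℝ) (q : β → ℝ) (r : γ → ℝ) (s : γ' → ℝ) (X : (α × β) × (γ × γ') → Ω) :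
    P (pr (pr p q) (pr r s)) X =
      P (pr (pr p r) (pr q s)) (fun ω => X ((ω.1.1, ω.2.1), (ω.1.2, ω.2.2))) := by
  rw [← P_reindex (Equiv.prodProdProdComm α β γ γ')]
  congr 1
  funext t; simp [pr]; ring

lemma P_swap' (p : α → ℝ) (q : β → ℝ) (r : γ → ℝ) (X : α × (β × γ) → Ω) :
    P (pr p (pr q r)) X =
      P (pr p (pr r q)) (fun ω => X (ω.1, (ω.2.2, ω.2.1))) := by
  rw [← P_reindex ((Equiv.refl α).prodCongr (Equiv.prodComm β γ))]
  congr 1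
  funext t; simp [pr, mul_comm]

lemma En_three {p q r : G → ℝ} (hp : Pr p) (hq : Pr q) (hr : Pr r) :
    En (pr (pr p q) r) (fun ω => (ω.1.1, ω.1.1 + ω.1.2 + ω.2)) = S p + S (conv q r) := by
  have h := En_eq_of ((hp.pr hq).pr hr).1 (fun ω => (ω.1.1, ω.1.1 + ω.1.2 + ω.2))
    (fun ω => (ω.1.1, ω.1.2 + ω.2)) (by
      rintro ω ω' - -
      simp only [Prod.mk.injEq]
      constructor
      · rintro ⟨h1, h2⟩
        refine ⟨h1, ?_⟩
        rw [h1, add_assoc, add_assoc] at h2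
        exact add_left_cancel h2
      · rintro ⟨h1, h2⟩
        refine ⟨h1, ?_⟩
        rw [h1, add_assoc, add_assoc, h2])
  rw [h, En, P_assoc]
  exact (En_pr p (pr q r) hp.2 (hq.pr hr).2 (fun x => x) (fun t => t.1 + t.2)).trans
    (by rw [En, P_id]; rfl)

lemma En_three' {p q r : G → ℝ} (hp : Pr p) (hq : Pr q) (hr : Pr r) :
    En (pr (pr p q) r) (fun ω => (ω.1.2, ω.1.1 + ω.1.2 + ω.2)) = S q + S (conv p r) := by
  rw [← En_three hq hp hr, En, En, P_swap]
  simp only [add_comm]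

lemma S_pr' {p : α → ℝ} {q : β → ℝ} (hp : Pr p) (hq : Pr q) : S (pr p q) = S p + S q := by
  rw [S_pr, hp.2, hq.2, one_mul, one_mul]

lemma madiman {p q r : G → ℝ} (hp : Pr p) (hq : Pr q) (hr : Pr r) :
    S (conv (conv p q) r) + S r ≤ S (conv p r) + S (conv q r) := by
  have h := submod ((hp.pr hq).pr hr).1 (fun ω => ω.1.1) (fun ω => ω.1.2)
    (fun ω => ω.1.1 + ω.1.2 + ω.2)
  rw [En_three hp hq hr, En_three' hp hq hr] at h
  have h2 := En_eq_of ((hp.pr hq).pr hr).1 (fun ω => (ω.1.1, ω.1.2, ω.1.1 + ω.1.2 + ω.2))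
    (fun ω => ω) (by
      rintro ⟨⟨a, b⟩, c⟩ ⟨⟨a', b'⟩, c'⟩ - -
      simp only [Prod.mk.injEq]
      constructor
      · rintro ⟨h1, h2, h3⟩
        refine ⟨⟨h1, h2⟩, ?_⟩
        rw [h1, h2] at h3
        exact add_left_cancel h3
      · rintro ⟨⟨h1, h2⟩, h3⟩
        simp [h1, h2, h3])
  have h3 : En (pr (pr p q) r) (fun ω => ω) = S p + S q + S r := by
    rw [En, P_id, S_pr' (hp.pr hq) hr, S_pr' hp hq]
  have h4 : S (conv (conv p q) r) = En (pr (pr p q) r) (fun ω => ω.1.1 + ω.1.2 + ω.2) := by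
    rw [En, conv, conv, ← conv, conv_P_left]
  linarith

lemma S_le_conv {p q : G → ℝ} (hp : Pr p) (hq : Pr q) : S q ≤ S (conv p q) := by
  have h := En_pair_le (hp.pr hq).1 (fun t => t.1) (fun t => t.1 + t.2)
  have h2 := En_eq_of (hp.pr hq).1 (fun t => (t.1, t.1 + t.2)) (fun t => t) (by
      rintro ⟨a, b⟩ ⟨a', b'⟩ - -
      simp only [Prod.mk.injEq]
      constructor
      · rintro ⟨h1, h2⟩
        rw [h1] at h2
        exact ⟨h1, add_left_cancel h2⟩
      · rintro ⟨h1, h2⟩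
        simp [h1, h2])
  have h3 : En (pr p q) (fun t => t.1) = S p := by
    rw [En, P_fst p q hq.2 (fun x => x), P_id]
  have h4 : En (pr p q) (fun t => t.1 + t.2) = S (conv p q) := rfl
  rw [h2, h3, h4, (hp.pr hq).2, negMulLog_one, En, P_id, S_pr' hp hq] at h
  linarith

lemma S_le_conv' {p q : G → ℝ} (hp : Pr p) (hq : Pr q) : S p ≤ S (conv p q) := by
  rw [conv_comm]; exact S_le_conv hq hp

lemma S_triangle {p q r : G → ℝ} (hp : Pr p) (hq : Pr q) (hr : Pr r) :
    S (conv p r) + S q ≤ S (conv p q) + S (conv q r) := by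
  have h1 := madiman hp hr hq
  have h2 := S_le_conv' (hp.conv hr) hq
  rw [conv_comm r q] at h1
  linarith

lemma D_triangle {p q r : G → ℝ} (hp : Pr p) (hq : Pr q) (hr : Pr r) :
    D p r ≤ D p q + D q r := by
  have := S_triangle hp hq hr
  rw [D_prob hp hr, D_prob hp hq, D_prob hq hr]
  linarith

lemma D_nonneg {p q : G → ℝ} (hp : Pr p) (hq : Pr q) : 0 ≤ D p q := by
  rw [D_prob hp hq]
  linarith [S_le_conv hp hq, S_le_conv' hp hq]

lemma D_comm (p q : G → ℝ) : D p q = D q p := by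
  rw [D, D, conv_comm]; ring

/-- restricted weight -/
lemma sl_eq (w : Ω → ℝ) (X : Ω → α) (Z : Ω → γ) (z : γ) :
    sl w X Z z = P (fun ω => if Z ω = z then w ω else 0) X := by
  funext x
  simp only [sl, P]
  refine sum_congr rfl fun ω _ => ?_
  by_cases h : X ω = x <;> by_cases h' : Z ω = z <;> simp [h, h']

lemma conv_sl (w : Ω → ℝ) (w' : Ω' → ℝ) (X : Ω → G) (X' : Ω' → G) (Z : Ω → γ) (Z' : Ω' → γ')
    (z : γ) (z' : γ') : conv (sl w X Z z) (sl w' X' Z' z') =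
      sl (pr w w') (fun ω => X ω.1 + X' ω.2) (fun ω => (Z ω.1, Z' ω.2)) (z, z') := by
  rw [sl_eq, sl_eq, sl_eq, conv_P]
  congr 1
  funext ω
  simp only [pr, Prod.mk.injEq]
  by_cases h : Z ω.1 = z <;> by_cases h' : Z' ω.2 = z' <;> simp [h, h']

lemma conv_sl_right (p : G → ℝ) (w : Ω → ℝ) (X : Ω → G) (Z : Ω → γ) (z : γ) :
    conv p (sl w X Z z) = sl (pr p w) (fun ω => ω.1 + X ω.2) (fun ω => Z ω.2) z := by
  rw [sl_eq, sl_eq, conv_P_right]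
  congr 1
  funext ω
  simp only [pr]
  by_cases h : Z ω.2 = z <;> simp [h]

lemma sumD1 {p : G → ℝ} {w : Ω → ℝ} (hp : Pr p) (hw : Pr w) (X : Ω → G) (Z : Ω → γ) :
    ∑ z, D p (sl w X Z z) ≤ S (conv p (P w X)) - (1/2) * S p
      - (1/2) * (En w (fun ω => (X ω, Z ω)) - En w Z) := by
  simp only [D, conv_sl_right, sum_sub_distrib, sum_ent_sl, hp.2, sum_sl, mul_one, ← mul_sum,
    ← sum_mul]
  rw [sum_P, hw.2, ent_prob hp.2]
  have h := En_pair_le (hp.pr hw).1 (fun ω => ω.1 + X ω.2) (fun ω => Z ω.2)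
  rw [(hp.pr hw).2, negMulLog_one] at h
  have h2 : En (pr p w) (fun ω => ω.1 + X ω.2) = S (conv p (P w X)) := by
    rw [conv_P_right]; rfl
  linarith

lemma sumD2 {w : Ω → ℝ} {w' : Ω' → ℝ} (hw : Pr w) (hw' : Pr w') (X : Ω → G) (Z : Ω → γ)
    (X' : Ω' → G) (Z' : Ω' → γ') :
    ∑ z, ∑ z', D (sl w X Z z) (sl w' X' Z' z') =
      En (pr w w') (fun ω => (X ω.1 + X' ω.2, (Z ω.1, Z' ω.2))) - En w Z - En w' Z'
      - (1/2) * (En w (fun ω => (X ω, Z ω)) - En w Z)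
      - (1/2) * (En w' (fun ω => (X' ω, Z' ω)) - En w' Z') := by
  simp only [D, conv_sl, sum_sub_distrib, sum_sl, ← mul_sum, ← sum_mul, sum_ent_sl]
  rw [sum_P, sum_P, hw.2, hw'.2, ← Fintype.sum_prod_type' (f := fun z z' =>
    ent (sl (pr w w') (fun ω => X ω.1 + X' ω.2) (fun ω => (Z ω.1, Z' ω.2)) (z, z')))]
  simp only [sum_ent_sl]
  rw [En_pr w w' hw.2 hw'.2]
  ring

end grp
end U3I

namespace U3I
set_option linter.unusedSectionVars false

section bsg
open Finset Real
open scoped Classical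

variable {Ω Ω' α β γ γ' : Type} [Fintype Ω] [Fintype Ω'] [Fintype α] [Fintype β] [Fintype γ]
  [Fintype γ']
variable {G : Type} [Fintype G] [AddCommGroup G]

/-- conditionally independent coupling -/
def w2 (w : Ω → ℝ) (Z : Ω → γ) (t : Ω × Ω) : ℝ :=
  if Z t.1 = Z t.2 then w t.1 * w t.2 / P w Z (Z t.1) else 0

lemma w2_symm (w : Ω → ℝ) (Z : Ω → γ) (a b : Ω) : w2 w Z (a, b) = w2 w Z (b, a) := by
  simp only [w2]
  by_cases h : Z a = Z b
  · rw [if_pos h, if_pos h.symm, h, mul_comm]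
  · rw [if_neg h, if_neg (Ne.symm h)]

lemma w2_nonneg {w : Ω → ℝ} (hw : ∀ ω, 0 ≤ w ω) (Z : Ω → γ) (t) : 0 ≤ w2 w Z t := by
  unfold w2
  split_ifs
  · exact div_nonneg (mul_nonneg (hw _) (hw _)) (P_nonneg hw _ _)
  · exact le_rfl

lemma w2_ne {w : Ω → ℝ} {Z : Ω → γ} {t : Ω × Ω} (h : w2 w Z t ≠ 0) : Z t.1 = Z t.2 := by
  by_contra h'
  exact h (by rw [w2, if_neg h'])

lemma w2_sum {w : Ω → ℝ} (hw : ∀ ω, 0 ≤ w ω) (Z : Ω → γ) (a : Ω) :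
    ∑ b, w2 w Z (a, b) = w a := by
  have : ∀ b, w2 w Z (a, b) = w a / P w Z (Z a) * (if Z b = Z a then w b else 0) := by
    intro b
    simp only [w2]
    by_cases h : Z a = Z b
    · rw [if_pos h, if_pos h.symm]; ring
    · rw [if_neg h, if_neg (Ne.symm h), mul_zero]
  simp only [this, ← mul_sum]
  change w a / P w Z (Z a) * P w Z (Z a) = w a
  by_cases h : P w Z (Z a) = 0
  · have := le_P hw Z a
    rw [h] at this
    rw [le_antisymm this (hw a)]; simp
  · exact div_mul_cancel₀ _ h

lemma w2_sum' {w : Ω → ℝ} (hw : ∀ ω, 0 ≤ w ω) (Z : Ω → γ) (a : Ω) :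
    ∑ b, w2 w Z (b, a) = w a := by
  simp only [w2_symm w Z _ a, w2_sum hw]

lemma P_w2_fst {w : Ω → ℝ} (hw : ∀ ω, 0 ≤ w ω) (Z : Ω → γ) (f : Ω → α) :
    P (w2 w Z) (fun t => f t.1) = P w f := by
  funext a
  simp only [P, Fintype.sum_prod_type]
  refine sum_congr rfl fun ω _ => ?_
  by_cases h : f ω = a <;> simp [h, w2_sum hw]

lemma P_w2_snd {w : Ω → ℝ} (hw : ∀ ω, 0 ≤ w ω) (Z : Ω → γ) (f : Ω → α) :
    P (w2 w Z) (fun t => f t.2) = P w f := by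
  funext a
  simp only [P, Fintype.sum_prod_type]
  rw [sum_comm]
  refine sum_congr rfl fun ω _ => ?_
  by_cases h : f ω = a <;> simp [h, w2_sum' hw]

lemma w2_total {w : Ω → ℝ} (hw : ∀ ω, 0 ≤ w ω) (Z : Ω → γ) :
    ∑ t, w2 w Z t = ∑ ω, w ω := by
  rw [Fintype.sum_prod_type]; simp only [w2_sum hw]

lemma S_w2 {w : Ω → ℝ} (hw : ∀ ω, 0 ≤ w ω) (Z : Ω → γ) :
    S (w2 w Z) = 2 * S w - En w Z := by
  have h1 : ∀ t : Ω × Ω, negMulLog (w2 w Z t) =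
      -(w2 w Z t * log (w t.1)) - (w2 w Z t * log (w t.2)) + w2 w Z t * log (P w Z (Z t.1)) := by
    intro t
    by_cases h0 : w2 w Z t = 0
    · simp [h0]
    have hz := w2_ne h0
    have e : w2 w Z t = w t.1 * w t.2 / P w Z (Z t.1) := by rw [w2, if_pos hz]
    have a1 : w t.1 ≠ 0 := by intro h; apply h0; rw [e, h]; simp
    have a2 : w t.2 ≠ 0 := by intro h; apply h0; rw [e, h]; simp
    have a3 : P w Z (Z t.1) ≠ 0 := by intro h; apply h0; rw [e, h]; simp
    rw [negMulLog]
    conv_lhs => rw [e, log_div (mul_ne_zero a1 a2) a3, log_mul a1 a2, ← e]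
    ring
  have hA : ∑ t, w2 w Z t * log (w t.1) = ∑ a, w a * log (w a) := by
    rw [Fintype.sum_prod_type]; simp only [← sum_mul, w2_sum hw]
  have hB : ∑ t, w2 w Z t * log (w t.2) = ∑ a, w a * log (w a) := by
    rw [Fintype.sum_prod_type, sum_comm]; simp only [← sum_mul, w2_sum' hw]
  have hC : ∑ t, w2 w Z t * log (P w Z (Z t.1)) = ∑ a, w a * log (P w Z (Z a)) := by
    rw [Fintype.sum_prod_type]; simp only [← sum_mul, w2_sum hw]
  have hS : S w = -∑ a, w a * log (w a) := by
    simp [S, negMulLog]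
  rw [En_eq, S]
  simp only [h1, sum_add_distrib, sum_sub_distrib, sum_neg_distrib, hA, hB, hC, hS]
  ring

lemma ent_of_sum_zero {μ : α → ℝ} (h : ∀ a, 0 ≤ μ a) (h0 : ∑ a, μ a = 0) : ent μ = 0 := by
  have : ∀ a, μ a = 0 := fun a => (sum_eq_zero_iff_of_nonneg (fun a _ => h a)).1 h0 a (mem_univ a)
  simp [ent, S, this]

/-- entropic Balog–Szemerédi–Gowers -/
lemma bsg (hG : ∀ x : G, x + x = 0) {w : G × G → ℝ} (hw : ∀ t, 0 ≤ w t) :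
    ∑ z, (P w (fun t => t.1 + t.2) z)⁻¹ *
        D (sl w (fun t => t.1) (fun t => t.1 + t.2) z) (sl w (fun t => t.2) (fun t => t.1 + t.2) z)
      ≤ 2 * En w (fun t => t.1) + 2 * En w (fun t => t.2) + 2 * En w (fun t => t.1 + t.2)
        - 3 * S w - 3 * negMulLog (∑ t, w t) := by
  set Z : G × G → G := fun t => t.1 + t.2 with hZ
  have hneg : ∀ x : G, -x = x := fun x => neg_eq_of_add_eq_zero_left (hG x)
  have hw2 := w2_nonneg hw Z
  -- the slices of the coupling
  have e1 : ∀ z, (P w Z z)⁻¹ * ent (conv (sl w (fun t => t.1) Z z) (sl w (fun t => t.2) Z z)) =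
      ent (sl (w2 w Z) (fun t => t.1.1 + t.2.2) (fun t => Z t.1) z) := by
    intro z
    rw [← ent_smul]
    congr 1
    rw [conv_sl]
    funext g
    simp only [sl, P, mul_sum]
    refine sum_congr rfl fun t _ => ?_
    simp only [Prod.mk.injEq, mul_ite, mul_zero, pr, w2]
    by_cases h1 : t.1.1 + t.2.2 = g
    · by_cases h2 : Z t.1 = z
      · by_cases h3 : Z t.2 = z
        · rw [if_pos ⟨h1, h2, h3⟩, if_pos ⟨h1, h2⟩, if_pos (h2.trans h3.symm), h2]
          simp only [P]
          ring
        · rw [if_neg (by tauto), if_pos ⟨h1, h2⟩, if_neg (by rw [h2]; exact Ne.symm h3)]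
      · rw [if_neg (by tauto), if_neg (by tauto)]
    · rw [if_neg (by tauto), if_neg (by tauto)]
  have mass1 : ∀ z, (P w Z z)⁻¹ * (P w Z z * ent (sl w (fun t => t.1) Z z)) =
      ent (sl w (fun t => t.1) Z z) := by
    intro z
    by_cases h : P w Z z = 0
    · rw [ent_of_sum_zero (sl_nonneg hw _ _ _) (by rw [sum_sl, h])]; simp
    · rw [inv_mul_cancel_left₀ h]
  have mass2 : ∀ z, (P w Z z)⁻¹ * (P w Z z * ent (sl w (fun t => t.2) Z z)) =
      ent (sl w (fun t => t.2) Z z) := by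
    intro z
    by_cases h : P w Z z = 0
    · rw [ent_of_sum_zero (sl_nonneg hw _ _ _) (by rw [sum_sl, h])]; simp
    · rw [inv_mul_cancel_left₀ h]
  have e2 : ∀ z, (P w Z z)⁻¹ * D (sl w (fun t => t.1) Z z) (sl w (fun t => t.2) Z z) =
      ent (sl (w2 w Z) (fun t => t.1.1 + t.2.2) (fun t => Z t.1) z)
        - (1/2) * ent (sl w (fun t => t.1) Z z) - (1/2) * ent (sl w (fun t => t.2) Z z) := by
    intro z
    rw [← e1, D, sum_sl, sum_sl]
    linear_combination (-1/2) * mass1 z + (-1/2) * mass2 z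
  simp only [e2, sum_sub_distrib, ← mul_sum, sum_ent_sl]
  have s1 : En w (fun t => (t.1, Z t)) = S w := by
    rw [En_eq_of hw (fun t => (t.1, Z t)) (fun t => t) ?_, En, P_id]
    rintro ⟨a, b⟩ ⟨a', b'⟩ - -
    simp only [Prod.mk.injEq, hZ]
    constructor
    · rintro ⟨h1, h2⟩
      rw [h1] at h2; exact ⟨h1, add_left_cancel h2⟩
    · rintro ⟨h1, h2⟩; simp [h1, h2]
  have s2 : En w (fun t => (t.2, Z t)) = S w := by
    rw [En_eq_of hw (fun t => (t.2, Z t)) (fun t => t) ?_, En, P_id]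
    rintro ⟨a, b⟩ ⟨a', b'⟩ - -
    simp only [Prod.mk.injEq, hZ]
    constructor
    · rintro ⟨h1, h2⟩
      rw [h1] at h2; exact ⟨add_right_cancel h2, h1⟩
    · rintro ⟨h1, h2⟩; simp [h1, h2]
  rw [s1, s2]
  have t1 := En_pair_le hw2 (fun t => t.1.1 + t.2.2) (fun t => Z t.1)
  rw [w2_total hw] at t1
  have t2 := submod hw2 (fun t => t.1.1) (fun t => t.1.2) (fun t => t.1.1 + t.2.2)
  -- identify the pieces
  have i1 : En (w2 w Z) (fun t => (t.1.1, t.1.2, t.1.1 + t.2.2)) = 2 * S w - En w Z := by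
    rw [← S_w2 hw Z, En_eq_of hw2 _ (fun t => t) ?_, En, P_id]
    rintro ⟨⟨a, b⟩, ⟨c, d⟩⟩ ⟨⟨a', b'⟩, ⟨c', d'⟩⟩ h h'
    have e := w2_ne h
    have e' := w2_ne h'
    simp only [Prod.mk.injEq, hZ] at e e' ⊢
    constructor
    · rintro ⟨h1, h2, h3⟩
      subst h1; subst h2
      have h4 := add_left_cancel h3
      subst h4
      exact ⟨⟨rfl, rfl⟩, add_right_cancel (e.symm.trans e'), rfl⟩
    · rintro ⟨⟨h1, h2⟩, h3, h4⟩; simp [h1, h2, h4]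
  have i2 : En (w2 w Z) (fun t => (t.1.1, t.1.1 + t.2.2)) + negMulLog (∑ t, w t) ≤
      En w (fun t => t.1) + En w (fun t => t.2) := by
    rw [En_eq_of hw2 _ (fun t => (t.1.1, t.2.2)) ?_]
    · have := En_pair_le hw2 (fun t => t.1.1) (fun t => t.2.2)
      rw [w2_total hw] at this
      refine this.trans (le_of_eq ?_)
      rw [En, En, P_w2_fst hw Z (fun t => t.1), P_w2_snd hw Z (fun t => t.2)]; rfl
    rintro ⟨⟨a, b⟩, ⟨c, d⟩⟩ ⟨⟨a', b'⟩, ⟨c', d'⟩⟩ - -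
    simp only [Prod.mk.injEq]
    constructor
    · rintro ⟨h1, h2⟩; subst h1; exact ⟨rfl, add_left_cancel h2⟩
    · rintro ⟨h1, h2⟩; simp [h1, h2]
  have i3 : En (w2 w Z) (fun t => (t.1.2, t.1.1 + t.2.2)) + negMulLog (∑ t, w t) ≤
      En w (fun t => t.1) + En w (fun t => t.2) := by
    rw [En_eq_of hw2 _ (fun t => (t.1.2, t.2.1)) ?_]
    · have := En_pair_le hw2 (fun t => t.1.2) (fun t => t.2.1)
      rw [w2_total hw] at this
      refine this.trans (le_of_eq ?_)
      rw [En, En, P_w2_fst hw Z (fun t => t.2), P_w2_snd hw Z (fun t => t.1), add_comm]; rfl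
    rintro ⟨⟨a, b⟩, ⟨c, d⟩⟩ ⟨⟨a', b'⟩, ⟨c', d'⟩⟩ h h'
    have e := w2_ne h
    have e' := w2_ne h'
    simp only [Prod.mk.injEq, hZ] at e e' ⊢
    have f : a + d = c + b := by
      have : a + b + (b + d) = c + d + (b + d) := by rw [e]
      linear_combination (norm := abel) this - hG b + hG d
    have f' : a' + d' = c' + b' := by
      have : a' + b' + (b' + d') = c' + d' + (b' + d') := by rw [e']
      linear_combination (norm := abel) this - hG b' + hG d'
    rw [f, f']
    constructor
    · rintro ⟨h1, h2⟩; subst h1; exact ⟨rfl, add_right_cancel h2⟩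
    · rintro ⟨h1, h2⟩; simp [h1, h2]
  have i4 : En (w2 w Z) (fun t => Z t.1) = En w Z := by
    rw [En, P_w2_fst hw Z Z]; rfl
  linarith

end bsg
end U3I

namespace U3I
set_option linter.unusedSectionVars false

section endgame
open Finset Real
open scoped Classical

variable {Ω Ω' α β γ γ' : Type} [Fintype Ω] [Fintype Ω'] [Fintype α] [Fintype β] [Fintype γ]
  [Fintype γ']
variable {G : Type} [Fintype G] [AddCommGroup G]

lemma conv_assoc (p q r : G → ℝ) : conv (conv p q) r = conv p (conv q r) := by
  have h1 : conv (conv p q) r = P (pr (pr p q) r) (fun ω => ω.1.1 + ω.1.2 + ω.2) := by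
    rw [conv, conv, ← conv, conv_P_left]
  have h2 : conv p (conv q r) = P (pr p (pr q r)) (fun ω => ω.1 + (ω.2.1 + ω.2.2)) := by
    rw [conv, conv, ← conv, conv_P_right]
  rw [h1, h2, P_assoc]
  simp only [add_assoc]

instance : Std.Associative (conv (G := G)) := ⟨conv_assoc⟩
instance : Std.Commutative (conv (G := G)) := ⟨conv_comm⟩

/-- the consequence of minimality which is used -/
def Star (p q : G → ℝ) (k η : ℝ) : Prop :=
  ∀ μ ν : G → ℝ, (∀ g, 0 ≤ μ g) → (∀ g, 0 ≤ ν g) →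
    k * (∑ g, μ g) * (∑ g, ν g) ≤ D μ ν + η * ((∑ g, ν g) * D p μ + (∑ g, μ g) * D q ν)

lemma En_fst_add {p q : G → ℝ} (hp : Pr p) (hq : Pr q) :
    En (pr p q) (fun t => (t.1, t.1 + t.2)) = S p + S q := by
  rw [En_eq_of (hp.pr hq).1 (fun t => (t.1, t.1 + t.2)) (fun t => t) ?_, En, P_id, S_pr' hp hq]
  rintro ⟨a, b⟩ ⟨a', b'⟩ - -
  simp only [Prod.mk.injEq]
  constructor
  · rintro ⟨h1, h2⟩
    rw [h1] at h2
    exact ⟨h1, add_left_cancel h2⟩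
  · rintro ⟨h1, h2⟩
    simp [h1, h2]

lemma P_fst' {p q : G → ℝ} (hq : Pr q) : P (pr p q) (fun t => t.1) = p := by
  rw [P_fst p q hq.2 (fun x => x), P_id]

lemma est {p q : G → ℝ} {k η : ℝ} (hS : Star p q k η) (hη : 0 ≤ η) (hp : Pr p) (hq : Pr q)
    {p1 p2 p3 p4 : G → ℝ} (h1 : Pr p1) (h2 : Pr p2) (h3 : Pr p3) (h4 : Pr p4) :
    2 * k ≤ (S (conv (conv p1 p3) (conv p2 p4)) - (1/2) * S (conv p1 p3) - (1/2) * S (conv p2 p4))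
      + (En (pr (pr p1 p3) (pr p2 p4))
            (fun ω => (ω.1.1 + ω.2.1, (ω.1.1 + ω.1.2, ω.2.1 + ω.2.2)))
          - S (conv p1 p3) - S (conv p2 p4)
          - (1/2) * (S p1 + S p3 - S (conv p1 p3)) - (1/2) * (S p2 + S p4 - S (conv p2 p4)))
      + η * (D p (conv p1 p3) + D q (conv p2 p4)
          + (S (conv p p1) - (1/2) * S p - (1/2) * (S p1 + S p3 - S (conv p1 p3)))
          + (S (conv q p2) - (1/2) * S q - (1/2) * (S p2 + S p4 - S (conv p2 p4)))) := by
  have hA := hS (conv p1 p3) (conv p2 p4) (h1.conv h3).1 (h2.conv h4).1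
  rw [(h1.conv h3).2, (h2.conv h4).2, D_prob (h1.conv h3) (h2.conv h4)] at hA
  set w := pr p1 p3
  set w' := pr p2 p4
  have hw : Pr w := h1.pr h3
  have hw' : Pr w' := h2.pr h4
  have hB : ∑ z, ∑ z', k * P w (fun t => t.1 + t.2) z * P w' (fun t => t.1 + t.2) z' ≤
      ∑ z, ∑ z', (D (sl w (fun t => t.1) (fun t => t.1 + t.2) z)
          (sl w' (fun t => t.1) (fun t => t.1 + t.2) z')
        + η * (P w' (fun t => t.1 + t.2) z' * D p (sl w (fun t => t.1) (fun t => t.1 + t.2) z)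
          + P w (fun t => t.1 + t.2) z * D q (sl w' (fun t => t.1) (fun t => t.1 + t.2) z'))) := by
    refine sum_le_sum fun z _ => sum_le_sum fun z' _ => ?_
    have := hS (sl w (fun t => t.1) (fun t => t.1 + t.2) z)
      (sl w' (fun t => t.1) (fun t => t.1 + t.2) z') (sl_nonneg hw.1 _ _ _) (sl_nonneg hw'.1 _ _ _)
    rwa [sum_sl, sum_sl] at this
  simp only [sum_add_distrib, ← mul_sum, ← sum_mul] at hB
  rw [sum_P, sum_P, hw.2, hw'.2, sumD2 hw hw'] at hB
  have c1 := sumD1 hp hw (fun t => t.1) (fun t => t.1 + t.2)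
  have c2 := sumD1 hq hw' (fun t => t.1) (fun t => t.1 + t.2)
  have e1 : En w (fun t => (t.1, t.1 + t.2)) = S p1 + S p3 := En_fst_add h1 h3
  have e2 : En w' (fun t => (t.1, t.1 + t.2)) = S p2 + S p4 := En_fst_add h2 h4
  have e3 : En w (fun t => t.1 + t.2) = S (conv p1 p3) := rfl
  have e4 : En w' (fun t => t.1 + t.2) = S (conv p2 p4) := rfl
  have e5 : P w (fun t => t.1) = p1 := P_fst' h3
  have e6 : P w' (fun t => t.1) = p2 := P_fst' h4
  rw [e1, e3, e5] at c1
  rw [e2, e4, e6] at c2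
  rw [e1, e2, e3, e4] at hB
  have c3 := mul_le_mul_of_nonneg_left (add_le_add c1 c2) hη
  linarith

lemma sl_sl (w : Ω → ℝ) (Y : Ω → α) (Z : Ω → γ) (z : γ) (f : α → β) (g : α → γ') (x : γ') :
    sl (sl w Y Z z) f g x = sl w (fun ω => f (Y ω)) (fun ω => (g (Y ω), Z ω)) (x, z) := by
  funext a
  rw [sl, P_sl]
  simp only [sl, P]
  refine sum_congr rfl fun ω _ => ?_
  simp only [Prod.mk.injEq, and_assoc]

lemma D_zero (p : G → ℝ) {μ : G → ℝ} (h : ∀ g, 0 ≤ μ g) (h0 : ∑ g, μ g = 0) : D p μ = 0 := by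
  have : ∀ a, μ a = 0 := fun a => (sum_eq_zero_iff_of_nonneg (fun a _ => h a)).1 h0 a (mem_univ a)
  have e : μ = fun g => 0 * μ g := by funext g; simp [this]
  have e' : p = fun g => 1 * p g := by funext g; simp
  rw [e, e', D_smul]; simp

lemma endgame (hG : ∀ x : G, x + x = 0) {p q : G → ℝ} {k η : ℝ} (hS : Star p q k η)
    (hη : 0 ≤ η) (hp : Pr p) (hq : Pr q) {w : Ω → ℝ} (hw : Pr w) (U V T : Ω → G) :
    k ≤ 2 * En w (fun ω => (U ω, T ω)) + 2 * En w (fun ω => (V ω, T ω))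
        + 2 * En w (fun ω => (U ω + V ω, T ω)) - 3 * En w (fun ω => ((U ω, V ω), T ω))
        - 3 * En w T
      + η * ((S (conv p (P w U)) - (1/2) * S p
          - (1/2) * (En w (fun ω => (U ω, (U ω + V ω, T ω))) - En w (fun ω => (U ω + V ω, T ω))))
        + (S (conv q (P w V)) - (1/2) * S q
          - (1/2) * (En w (fun ω => (V ω, (U ω + V ω, T ω)))
            - En w (fun ω => (U ω + V ω, T ω))))) := by
  have hb : ∀ s, _ := fun s => bsg hG (w := sl w (fun ω => (U ω, V ω)) T s) (sl_nonneg hw.1 _ _ _)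
  have hb' := sum_le_sum fun s (_ : s ∈ univ) => hb s
  have m1 : ∀ s z, P (sl w (fun ω => (U ω, V ω)) T s) (fun t => t.1 + t.2) z =
      P w (fun ω => (U ω + V ω, T ω)) (z, s) := by
    intro s z; rw [P_sl]; rfl
  simp only [sl_sl, m1, sum_sub_distrib, sum_add_distrib, ← mul_sum, sum_En_sl, sum_sl] at hb'
  have m2 : ∑ s, S (sl w (fun ω => (U ω, V ω)) T s) = En w (fun ω => ((U ω, V ω), T ω)) := by
    rw [← sum_En_sl w (fun ω => (U ω, V ω)) T (fun t => t)]
    simp only [En, P_id]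
  have m3 : ∑ s, negMulLog (P w T s) = En w T := rfl
  rw [m2, m3] at hb'
  have st : ∀ t : G × G, k * P w (fun ω => (U ω + V ω, T ω)) t ≤
      (P w (fun ω => (U ω + V ω, T ω)) t)⁻¹ *
        D (sl w U (fun ω => (U ω + V ω, T ω)) t) (sl w V (fun ω => (U ω + V ω, T ω)) t)
      + η * (D p (sl w U (fun ω => (U ω + V ω, T ω)) t)
        + D q (sl w V (fun ω => (U ω + V ω, T ω)) t)) := by
    intro t
    have := hS _ _ (sl_nonneg hw.1 U (fun ω => (U ω + V ω, T ω)) t)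
      (sl_nonneg hw.1 V (fun ω => (U ω + V ω, T ω)) t)
    rw [sum_sl, sum_sl] at this
    by_cases h0 : P w (fun ω => (U ω + V ω, T ω)) t = 0
    · rw [D_zero p (sl_nonneg hw.1 _ _ _) (by rw [sum_sl, h0]),
        D_zero q (sl_nonneg hw.1 _ _ _) (by rw [sum_sl, h0]), h0]
      simp
    · have hpos : 0 < P w (fun ω => (U ω + V ω, T ω)) t :=
        lt_of_le_of_ne (P_nonneg hw.1 _ _) (Ne.symm h0)
      have h3 := mul_le_mul_of_nonneg_left this (inv_nonneg.2 hpos.le)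
      refine le_trans (le_of_eq ?_) (h3.trans (le_of_eq ?_))
      · field_simp
      · field_simp
  have st' := sum_le_sum fun t (_ : t ∈ univ) => st t
  simp only [sum_add_distrib, ← mul_sum] at st'
  rw [sum_P, hw.2] at st'
  have c1 := sumD1 hp hw U (fun ω => (U ω + V ω, T ω))
  have c2 := sumD1 hq hw V (fun ω => (U ω + V ω, T ω))
  have c3 := mul_le_mul_of_nonneg_left (add_le_add c1 c2) hη
  rw [Fintype.sum_prod_type, sum_comm] at st'
  linarith

/-- the four variables give `k ≤ 0` -/
lemma star_zero (hG : ∀ x : G, x + x = 0) {p q : G → ℝ} (hp : Pr p) (hq : Pr q)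
    (hS : Star p q (D p q) (1/100)) : D p q ≤ 0 := by
  have hη : (0:ℝ) ≤ 1/100 := by norm_num
  set w := pr (pr p p) (pr q q) with hwdef
  have hw : Pr w := (hp.pr hp).pr (hq.pr hq)
  set U : (G × G) × (G × G) → G := fun ω => ω.1.1 + ω.2.1 with hU
  set V : (G × G) × (G × G) → G := fun ω => ω.1.2 + ω.2.1 with hV
  set T : (G × G) × (G × G) → G := fun ω => (ω.1.1 + ω.1.2) + (ω.2.1 + ω.2.2) with hT
  have E1 := est hS hη hp hq hp hq hq hp
  have E2 := est hS hη hp hq hp hq hp hq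
  have E3 := endgame hG hS hη hp hq hw U V T
  rw [← hwdef] at E2
  -- s
  have s2 : S (conv (conv p p) (conv q q)) = En w T := by
    rw [conv, conv, conv, ← conv, conv_P]; rfl
  have s1 : S (conv (conv p q) (conv q p)) = En w T := by
    rw [← s2]; congr 1; ac_rfl
  -- t
  have t2 : En w (fun ω => (ω.1.1 + ω.2.1, (ω.1.1 + ω.1.2, ω.2.1 + ω.2.2)))
      = En w (fun ω => ((U ω, V ω), T ω)) := by
    apply En_eq_of hw.1
    rintro ⟨⟨x, x'⟩, ⟨y, y'⟩⟩ ⟨⟨X, X'⟩, ⟨Y, Y'⟩⟩ - -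
    simp only [Prod.mk.injEq, hU, hV, hT]
    constructor
    · rintro ⟨a, b, c⟩
      refine ⟨⟨a, ?_⟩, ?_⟩
      · linear_combination (norm := abel) a + b - hG x + hG X
      · linear_combination (norm := abel) b + c
    · rintro ⟨⟨a, b⟩, c⟩
      refine ⟨a, ?_, ?_⟩
      · linear_combination (norm := abel) a + b - hG y + hG Y
      · linear_combination (norm := abel) c - a - b + hG y - hG Y
  have t1 : En (pr (pr p q) (pr q p)) (fun ω => (ω.1.1 + ω.2.1, (ω.1.1 + ω.1.2, ω.2.1 + ω.2.2)))
      = En w (fun ω => ((U ω, V ω), T ω)) := by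
    rw [En, P_swap', P_comm4, ← hwdef]
    change En w _ = _
    apply En_eq_of hw.1
    rintro ⟨⟨x, x'⟩, ⟨y, y'⟩⟩ ⟨⟨X, X'⟩, ⟨Y, Y'⟩⟩ - -
    simp only [Prod.mk.injEq, hU, hV, hT]
    constructor
    · rintro ⟨a, b, c⟩
      refine ⟨⟨b, ?_⟩, ?_⟩
      · linear_combination (norm := abel) a + b + c - hG x + hG X - hG y' + hG Y'
      · linear_combination (norm := abel) b + c
    · rintro ⟨⟨a, b⟩, c⟩
      refine ⟨?_, a, ?_⟩
      · linear_combination (norm := abel) c - b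
      · linear_combination (norm := abel) c - a
  have tU : En w (fun ω => (U ω, (U ω + V ω, T ω))) = En w (fun ω => ((U ω, V ω), T ω)) := by
    apply En_eq_of hw.1
    rintro ω ω' - -
    simp only [Prod.mk.injEq]
    constructor
    · rintro ⟨a, b, c⟩
      rw [a] at b
      exact ⟨⟨a, add_left_cancel b⟩, c⟩
    · rintro ⟨⟨a, b⟩, c⟩
      exact ⟨a, by rw [a, b], c⟩
  have tV : En w (fun ω => (V ω, (U ω + V ω, T ω))) = En w (fun ω => ((U ω, V ω), T ω)) := by
    apply En_eq_of hw.1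
    rintro ω ω' - -
    simp only [Prod.mk.injEq]
    constructor
    · rintro ⟨a, b, c⟩
      rw [a] at b
      exact ⟨⟨add_right_cancel b, a⟩, c⟩
    · rintro ⟨⟨a, b⟩, c⟩
      exact ⟨b, by rw [a, b], c⟩
  -- pairs
  have uT : En w (fun ω => (U ω, T ω)) = S (conv p q) + S (conv p q) := by
    rw [En_eq_of hw.1 _ (fun ω => (ω.1.1 + ω.2.1, ω.1.2 + ω.2.2)) ?_]
    · rw [En, hwdef, P_comm4]
      exact En_pr (pr p q) (pr p q) (hp.pr hq).2 (hp.pr hq).2 (fun t => t.1 + t.2)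
        (fun t => t.1 + t.2)
    rintro ⟨⟨x, x'⟩, ⟨y, y'⟩⟩ ⟨⟨X, X'⟩, ⟨Y, Y'⟩⟩ - -
    simp only [Prod.mk.injEq, hU, hT]
    constructor
    · rintro ⟨a, b⟩
      exact ⟨a, by linear_combination (norm := abel) b - a⟩
    · rintro ⟨a, b⟩
      exact ⟨a, by linear_combination (norm := abel) b + a⟩
  have vT : En w (fun ω => (V ω, T ω)) = S (conv p q) + S (conv p q) := by
    rw [En_eq_of hw.1 _ (fun ω => (ω.1.1 + ω.2.2, ω.1.2 + ω.2.1)) ?_]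
    · rw [En, hwdef, P_swap', P_comm4]
      exact En_pr (pr p q) (pr p q) (hp.pr hq).2 (hp.pr hq).2 (fun t => t.1 + t.2)
        (fun t => t.1 + t.2)
    rintro ⟨⟨x, x'⟩, ⟨y, y'⟩⟩ ⟨⟨X, X'⟩, ⟨Y, Y'⟩⟩ - -
    simp only [Prod.mk.injEq, hV, hT]
    constructor
    · rintro ⟨a, b⟩
      exact ⟨by linear_combination (norm := abel) b - a, a⟩
    · rintro ⟨a, b⟩
      exact ⟨b, by linear_combination (norm := abel) b + a⟩
  have wT : En w (fun ω => (U ω + V ω, T ω)) = S (conv p p) + S (conv q q) := by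
    rw [En_eq_of hw.1 _ (fun ω => (ω.1.1 + ω.1.2, ω.2.1 + ω.2.2)) ?_]
    · exact En_pr (pr p p) (pr q q) (hp.pr hp).2 (hq.pr hq).2 (fun t => t.1 + t.2)
        (fun t => t.1 + t.2)
    rintro ⟨⟨x, x'⟩, ⟨y, y'⟩⟩ ⟨⟨X, X'⟩, ⟨Y, Y'⟩⟩ - -
    simp only [Prod.mk.injEq, hU, hV, hT]
    constructor
    · rintro ⟨a, b⟩
      exact ⟨by linear_combination (norm := abel) a - hG y + hG Y,
        by linear_combination (norm := abel) b - a + hG y - hG Y⟩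
    · rintro ⟨a, b⟩
      exact ⟨by linear_combination (norm := abel) a + hG y - hG Y,
        by linear_combination (norm := abel) a + b⟩
  have pU : P w U = conv p q := by
    rw [hwdef, P_comm4]
    exact P_fst (pr p q) (pr p q) (hp.pr hq).2 (fun t => t.1 + t.2)
  have pV : P w V = conv p q := by
    rw [hwdef, P_swap, P_comm4]
    exact P_fst (pr p q) (pr p q) (hp.pr hq).2 (fun t => t.1 + t.2)
  have Sw : S w = 2 * S p + 2 * S q := by
    rw [hwdef, S_pr' (hp.pr hp) (hq.pr hq), S_pr' hp hp, S_pr' hq hq]; ring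
  have px : En w (fun ω => ω.1.1) = S p := by
    rw [En, hwdef, P_fst (pr p p) (pr q q) (hq.pr hq).2 (fun t => t.1), P_fst' hp]
  have py : En w (fun ω => ω.2.1) = S q := by
    rw [En, hwdef, P_snd (pr p p) (pr q q) (hp.pr hp).2 (fun t => t.1), P_fst' hq]
  have tx : S w ≤ En w (fun ω => ((U ω, V ω), T ω)) + S p := by
    have h1 := En_pair_le hw.1 (fun ω => ((U ω, V ω), T ω)) (fun ω => ω.1.1)
    rw [px, hw.2, negMulLog_one, add_zero] at h1
    refine le_trans (le_of_eq ?_) h1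
    rw [← P_id w, ← En]
    rw [P_id w]
    apply En_eq_of hw.1
    rintro ⟨⟨x, x'⟩, ⟨y, y'⟩⟩ ⟨⟨X, X'⟩, ⟨Y, Y'⟩⟩ - -
    simp only [Prod.mk.injEq, hU, hV, hT]
    constructor
    · rintro ⟨⟨rfl, rfl⟩, rfl, rfl⟩; simp
    · rintro ⟨⟨⟨a, b⟩, c⟩, rfl⟩
      have a' := add_left_cancel a
      subst a'
      have b' := add_right_cancel b
      subst b'
      have c' := add_left_cancel (add_left_cancel c)
      subst c'
      simp
  have ty : S w ≤ En w (fun ω => ((U ω, V ω), T ω)) + S q := by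
    have h1 := En_pair_le hw.1 (fun ω => ((U ω, V ω), T ω)) (fun ω => ω.2.1)
    rw [py, hw.2, negMulLog_one, add_zero] at h1
    refine le_trans (le_of_eq ?_) h1
    rw [← P_id w, ← En]
    rw [P_id w]
    apply En_eq_of hw.1
    rintro ⟨⟨x, x'⟩, ⟨y, y'⟩⟩ ⟨⟨X, X'⟩, ⟨Y, Y'⟩⟩ - -
    simp only [Prod.mk.injEq, hU, hV, hT]
    constructor
    · rintro ⟨⟨rfl, rfl⟩, rfl, rfl⟩; simp
    · rintro ⟨⟨⟨a, b⟩, c⟩, rfl⟩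
      have a' := add_right_cancel a
      subst a'
      have b' := add_right_cancel b
      subst b'
      have c' := add_left_cancel (add_left_cancel c)
      subst c'
      simp
  have hpq := hp.conv hq
  have b1 : S (conv p p) + S q ≤ S (conv p q) + S (conv p q) := by
    have := S_triangle hp hq hp
    rwa [conv_comm q p] at this
  have b2 : S (conv q q) + S p ≤ S (conv p q) + S (conv p q) := by
    have := S_triangle hq hp hq
    rwa [conv_comm q p] at this
  have b3 : S (conv p (conv p q)) + S q ≤ S (conv p q) + S (conv p q) := by
    have := madiman hp hp hq
    rwa [conv_assoc] at this
  have b4 : S (conv q (conv p q)) + S p ≤ S (conv p q) + S (conv p q) := by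
    have := madiman hq hq hp
    rwa [conv_assoc, conv_comm q p] at this
  have b5 : S (conv p (conv p p)) + S p ≤ S (conv p p) + S (conv p p) := by
    have := madiman hp hp hp
    rwa [conv_assoc] at this
  have b6 : S (conv q (conv q q)) + S q ≤ S (conv q q) + S (conv q q) := by
    have := madiman hq hq hq
    rwa [conv_assoc] at this
  have b7 := S_le_conv hp hq
  have b8 := S_le_conv' hp hq
  rw [s1, t1, conv_comm q p, D_prob hp hq, D_prob hp hpq, D_prob hq hpq] at E1
  rw [s2, t2, D_prob hp hq, D_prob hp (hp.conv hp), D_prob hq (hq.conv hq)] at E2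
  rw [uT, vT, wT, tU, tV, pU, pV, D_prob hp hq] at E3
  rw [D_prob hp hq]
  rw [Sw] at tx ty
  linarith

end endgame
end U3I

namespace U3I
set_option linter.unusedSectionVars false

section pfr
open Finset Real
open scoped Classical

variable {G : Type} [Fintype G] [AddCommGroup G]

lemma D_cont : Continuous (fun x : (G → ℝ) × (G → ℝ) => D x.1 x.2) := by
  have h := Real.continuous_negMulLog
  have hc : ∀ a, Continuous (fun x : (G → ℝ) × (G → ℝ) => conv x.1 x.2 a) := by
    intro a
    unfold conv P pr
    refine continuous_finsetSum _ fun t _ => ?_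
    by_cases ht : t.1 + t.2 = a
    · simp only [if_pos ht]; fun_prop
    · simp only [if_neg ht]; fun_prop
  unfold D ent S
  fun_prop

lemma star_of_min {p0 p q : G → ℝ} (h0 : Pr p0) (hp : Pr p) (hq : Pr q) {η : ℝ} (hη : 0 ≤ η)
    (hmin : ∀ μ ν, Pr μ → Pr ν → D p q + η * (D p0 p + D p0 q) ≤
      D μ ν + η * (D p0 μ + D p0 ν)) : Star p q (D p q) η := by
  have norm1 : ∀ μ ν : G → ℝ, Pr μ → Pr ν → D p q ≤ D μ ν + η * (D p μ + D q ν) := by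
    intro μ ν hμ hν
    have h1 := hmin μ ν hμ hν
    have h2 := D_triangle h0 hp hμ
    have h3 := D_triangle h0 hq hν
    have h4 := mul_le_mul_of_nonneg_left (add_le_add h2 h3) hη
    linarith
  intro μ ν hμ hν
  set a := ∑ g, μ g with ha
  set b := ∑ g, ν g with hb
  by_cases ha0 : a = 0
  · rw [D_comm μ ν, D_zero ν hμ ha0, D_zero p hμ ha0, ha0]; simp
  by_cases hb0 : b = 0
  · rw [D_zero μ hν hb0, D_zero q hν hb0, hb0]; simp
  have hapos : 0 < a := lt_of_le_of_ne (sum_nonneg fun g _ => hμ g) (Ne.symm ha0)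
  have hbpos : 0 < b := lt_of_le_of_ne (sum_nonneg fun g _ => hν g) (Ne.symm hb0)
  set μ' : G → ℝ := fun g => a⁻¹ * μ g with hμ'
  set ν' : G → ℝ := fun g => b⁻¹ * ν g with hν'
  have pμ : Pr μ' := ⟨fun g => mul_nonneg (inv_nonneg.2 hapos.le) (hμ g), by
    rw [hμ', ← mul_sum, ← ha, inv_mul_cancel₀ ha0]⟩
  have pν : Pr ν' := ⟨fun g => mul_nonneg (inv_nonneg.2 hbpos.le) (hν g), by
    rw [hν', ← mul_sum, ← hb, inv_mul_cancel₀ hb0]⟩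
  have eμ : μ = fun g => a * μ' g := by funext g; simp [hμ', mul_inv_cancel_left₀ ha0]
  have eν : ν = fun g => b * ν' g := by funext g; simp [hν', mul_inv_cancel_left₀ hb0]
  have d1 : D μ ν = a * b * D μ' ν' := by
    conv_lhs => rw [eμ, eν]
    rw [D_smul]
  have one : ∀ r : G → ℝ, r = fun g => 1 * r g := fun r => by funext g; simp
  have d2 : D p μ = a * D p μ' := by
    conv_lhs => rw [eμ, one p]
    rw [D_smul, one_mul]
  have d3 : D q ν = b * D q ν' := by
    conv_lhs => rw [eν, one q]
    rw [D_smul, one_mul]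
  rw [d1, d2, d3]
  have := mul_le_mul_of_nonneg_left (norm1 μ' ν' pμ pν) (mul_nonneg hapos.le hbpos.le)
  linarith

lemma exists_min (hG : ∀ x : G, x + x = 0) {p0 : G → ℝ} (h0 : Pr p0) :
    ∃ p : G → ℝ, Pr p ∧ S (conv p p) ≤ S p ∧ D p0 p ≤ 102 * D p0 p0 := by
  have hc : IsCompact (stdSimplex ℝ G ×ˢ stdSimplex ℝ G) :=
    (isCompact_stdSimplex (𝕜 := ℝ) (ι := G)).prod (isCompact_stdSimplex (𝕜 := ℝ) (ι := G))
  have hcont : Continuous (fun x : (G → ℝ) × (G → ℝ) =>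
      D x.1 x.2 + (1/100 : ℝ) * (D p0 x.1 + D p0 x.2)) := by
    have h1 : Continuous (fun x : (G → ℝ) × (G → ℝ) => D p0 x.1) :=
      Continuous.comp (g := fun y : (G → ℝ) × (G → ℝ) => D y.1 y.2)
        (f := fun x : (G → ℝ) × (G → ℝ) => (p0, x.1)) D_cont (by fun_prop)
    have h2 : Continuous (fun x : (G → ℝ) × (G → ℝ) => D p0 x.2) :=
      Continuous.comp (g := fun y : (G → ℝ) × (G → ℝ) => D y.1 y.2)
        (f := fun x : (G → ℝ) × (G → ℝ) => (p0, x.2)) D_cont (by fun_prop)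
    exact Continuous.add D_cont (Continuous.mul continuous_const (Continuous.add h1 h2))
  obtain ⟨⟨p, q⟩, hmem, hmin⟩ := hc.exists_isMinOn ⟨(p0, p0), Set.mk_mem_prod (show p0 ∈ stdSimplex ℝ G from h0) (show p0 ∈ stdSimplex ℝ G from h0)⟩ hcont.continuousOn
  have hp : Pr p := (Set.mem_prod.1 hmem).1
  have hq : Pr q := (Set.mem_prod.1 hmem).2
  have hmin' : ∀ μ ν, Pr μ → Pr ν → D p q + (1/100 : ℝ) * (D p0 p + D p0 q) ≤
      D μ ν + (1/100 : ℝ) * (D p0 μ + D p0 ν) := fun μ ν hμ hν =>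
    isMinOn_iff.1 hmin (μ, ν) (Set.mk_mem_prod (show μ ∈ stdSimplex ℝ G from hμ) (show ν ∈ stdSimplex ℝ G from hν))
  have hz := star_zero hG hp hq (star_of_min h0 hp hq (by norm_num) hmin')
  refine ⟨p, hp, ?_, ?_⟩
  · rw [D_prob hp hq] at hz
    have := S_triangle hp hq hp
    rw [conv_comm q p] at this
    linarith [S_le_conv hp hq, S_le_conv' hp hq]
  · have := hmin' p0 p0 h0 h0
    linarith [D_nonneg hp hq, D_nonneg h0 hq]

lemma conv_apply (hG : ∀ x : G, x + x = 0) (p q : G → ℝ) (x : G) :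
    conv p q x = ∑ y, p y * q (x + y) := by
  simp only [conv, P, pr, Fintype.sum_prod_type]
  refine sum_congr rfl fun y _ => ?_
  rw [sum_eq_single (x + y)]
  · rw [if_pos]
    rw [add_comm x y, ← add_assoc, hG, zero_add]
  · intro b _ hb
    rw [if_neg]
    intro h
    apply hb
    rw [← h, add_comm, ← add_assoc, hG, zero_add]
  · simp

lemma sum_shift (F : G → ℝ) (y : G) : ∑ x, F (x + y) = ∑ x, F x :=
  Equiv.sum_comp (Equiv.addRight y) F

/-- equality case -/
lemma eq_case (hG : ∀ x : G, x + x = 0) {p : G → ℝ} (hp : Pr p) (h : S (conv p p) ≤ S p)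
    {y y' : G} (hy : p y ≠ 0) (hy' : p y' ≠ 0) (x : G) : p (x + y) = p (x + y') := by
  have hle : ∀ x, ∑ y, p y * negMulLog (p (x + y)) ≤ negMulLog (conv p p x) := by
    intro x
    rw [conv_apply hG]
    have := concaveOn_negMulLog.le_map_sum (t := univ) (w := p) (p := fun y => p (x + y))
      (fun i _ => hp.1 i) hp.2 (fun i _ => hp.1 _)
    simpa [smul_eq_mul] using this
  have hsum : ∑ x, ∑ y, p y * negMulLog (p (x + y)) = S p := by
    rw [sum_comm]
    simp only [← mul_sum]
    rw [show S p = ∑ y, p y * S p by rw [← sum_mul, hp.2, one_mul]]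
    refine sum_congr rfl fun y _ => ?_
    rw [S, sum_shift (fun x => negMulLog (p x))]
  have heq : ∀ x ∈ univ, ∑ y, p y * negMulLog (p (x + y)) = negMulLog (conv p p x) := by
    refine (sum_eq_sum_iff_of_le fun x _ => hle x).1 (le_antisymm (sum_le_sum fun x _ => hle x) ?_)
    rw [hsum]; exact h
  have hx := heq x (mem_univ x)
  have key := (strictConcaveOn_negMulLog.map_sum_eq_iff' (t := univ) (w := p)
    (p := fun y => p (x + y)) (fun i _ => hp.1 i) hp.2 (fun i _ => hp.1 _)).1
    (by simpa [smul_eq_mul, conv_apply hG] using hx.symm)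
  rw [key y (mem_univ y) hy, key y' (mem_univ y') hy']

/-- cardinality of a subgroup, as a real number -/
def cd (H : AddSubgroup G) : ℝ := ∑ x, if x ∈ H then (1 : ℝ) else 0

lemma exists_large {r : G → ℝ} (hr : Pr r) : ∃ g, exp (-S r) ≤ r g := by
  by_contra! hcon
  have hlt : ∀ g, r g * S r ≤ negMulLog (r g) := by
    intro g
    rcases (hr.1 g).eq_or_lt with h | h
    · simp [← h]
    · have := (log_lt_iff_lt_exp h).2 (hcon g)
      rw [negMulLog]; nlinarith
  have hne : ∃ g, r g ≠ 0 := by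
    by_contra! h0
    have := hr.2
    simp [h0] at this
  obtain ⟨g, hg⟩ := hne
  have hgpos : 0 < r g := lt_of_le_of_ne (hr.1 g) (Ne.symm hg)
  have : ∑ g, r g * S r < ∑ g, negMulLog (r g) := by
    refine sum_lt_sum (fun g _ => hlt g) ⟨g, mem_univ g, ?_⟩
    have := (log_lt_iff_lt_exp hgpos).2 (hcon g)
    rw [negMulLog]; nlinarith
  rw [← sum_mul, hr.2, one_mul] at this
  exact lt_irrefl _ this

/-- polynomial Freiman–Ruzsa, entropy form -/
lemma pfr (hG : ∀ x : G, x + x = 0) {p0 : G → ℝ} (h0 : Pr p0) :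
    ∃ (H : AddSubgroup G) (g : G),
      exp (-(204 * D p0 p0)) ≤ ∑ x, (if x + g ∈ H then p0 x else 0) ∧
      log (cd H) ≤ S p0 + 204 * D p0 p0 := by
  obtain ⟨p, hp, hS, hD⟩ := exists_min hG h0
  have hne : ∃ g, p g ≠ 0 := by
    by_contra! h0
    have := hp.2
    simp [h0] at this
  obtain ⟨y0, hy0⟩ := hne
  let H : AddSubgroup G :=
    { carrier := {h | ∀ x, p (x + h) = p x}
      add_mem' := by
        intro a b ha hb x
        rw [← add_assoc, hb, ha]
      zero_mem' := by intro x; simp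
      neg_mem' := by
        intro a ha x
        have := ha (x + -a)
        simpa using this.symm }
  have hH : ∀ h, h ∈ H ↔ ∀ x, p (x + h) = p x := fun h => Iff.rfl
  have hsup : ∀ y, p y = if y + y0 ∈ H then p y0 else 0 := by
    intro y
    split_ifs with hm
    · have := (hH _).1 hm y0
      rw [← this, show y0 + (y + y0) = y + (y0 + y0) by abel, hG, add_zero]
    · by_contra hy
      apply hm
      rw [hH]
      intro x
      have := eq_case hG hp hS hy hy0 (x + y)
      rw [add_assoc x y y, hG, add_zero] at this
      rw [this, add_assoc]
  have hcoset : ∀ c : ℝ, ∑ y, (if y + y0 ∈ H then c else 0) = c * cd H := by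
    intro c
    rw [sum_shift (fun y => if y ∈ H then c else 0), cd, mul_sum]
    exact sum_congr rfl fun x _ => by split_ifs <;> simp
  set c := p y0 with hc
  have hc1 : c * cd H = 1 := by
    rw [← hcoset, ← hp.2]
    exact sum_congr rfl fun y _ => (hsup y).symm
  have hcpos : 0 < c := lt_of_le_of_ne (hp.1 _) (Ne.symm hy0)
  have hcdpos : 0 < cd H := by
    by_contra! h
    nlinarith
  have hcinv : c = (cd H)⁻¹ := by
    field_simp; exact hc1
  have hSp : S p = log (cd H) := by
    rw [S]
    have : ∀ y, negMulLog (p y) = if y + y0 ∈ H then negMulLog c else 0 := by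
      intro y
      rw [hsup y]
      split_ifs <;> simp
    simp only [this]
    rw [hcoset, negMulLog, hcinv, log_inv]
    field_simp
  obtain ⟨g, hg⟩ := exists_large (h0.conv hp)
  have hDe := D_prob h0 hp
  have l1 := S_le_conv' h0 hp
  have l2 := S_le_conv h0 hp
  refine ⟨H, g + y0, ?_, ?_⟩
  · rw [conv_apply hG] at hg
    have e1 : ∑ y, p0 y * p (g + y) = c * ∑ x, (if x + (g + y0) ∈ H then p0 x else 0) := by
      rw [mul_sum]
      refine sum_congr rfl fun x _ => ?_
      rw [hsup (g + x), show g + x + y0 = x + (g + y0) by abel]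
      split_ifs <;> ring
    rw [e1] at hg
    have e2 : exp (S p) * exp (-S (conv p0 p)) ≤ ∑ x, (if x + (g + y0) ∈ H then p0 x else 0) := by
      rw [hSp, exp_log hcdpos]
      calc cd H * exp (-S (conv p0 p)) ≤ cd H * (c * _) := by gcongr
        _ = _ := by rw [← mul_assoc, mul_comm (cd H), hc1, one_mul]
    refine le_trans ?_ e2
    rw [← exp_add]
    apply exp_le_exp.2
    linarith
  · rw [← hSp]
    linarith

end pfr
end U3I

namespace U3I
set_option linter.unusedSectionVars false

section stageone
open Finset Real
open scoped Classical

variable {α : Type} [Fintype α]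
variable {G : Type} [Fintype G] [AddCommGroup G]

/-- self-dual nonnegative functions -/
structure SD (χ : G → G → ℝ) (N : ℝ) (q : G → ℝ) : Prop where
  symm : ∀ x y, χ x y = χ y x
  add : ∀ z x y, χ z (x + y) = χ z x * χ z y
  le : ∀ z x, χ z x ≤ 1
  pos : ∀ (H : AddSubgroup G) z, 0 ≤ ∑ x, (if x ∈ H then χ z x else 0)
  Npos : 0 < N
  q0 : ∀ x, 0 ≤ q x
  q1 : ∀ x, q x ≤ 1
  qsum : ∑ x, q x ≤ N
  ft : ∀ z, ∑ x, q x * χ z x = N * q z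

lemma SD.pd {χ : G → G → ℝ} {N : ℝ} {q : G → ℝ} (h : SD χ N q) (H : AddSubgroup G) (g : G) :
    ∑ x, (if x ∈ H then q (x + g) else 0) ≤ ∑ x, (if x ∈ H then q x else 0) := by
  have key : ∀ g, N * ∑ x, (if x ∈ H then q (x + g) else 0) =
      ∑ z, q z * χ z g * ∑ x, (if x ∈ H then χ z x else 0) := by
    intro g
    simp only [mul_sum]
    rw [sum_comm]
    refine sum_congr rfl fun x _ => ?_
    split_ifs
    · rw [← h.ft]
      refine sum_congr rfl fun z _ => ?_
      rw [h.symm (x + g) z, h.add]; ring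
    · simp
  have h2 : N * ∑ x, (if x ∈ H then q (x + g) else 0) ≤
      N * ∑ x, (if x ∈ H then q x else 0) := by
    have k0 := key 0
    simp only [add_zero] at k0
    rw [key, k0]
    refine sum_le_sum fun z _ => mul_le_mul_of_nonneg_right ?_ (h.pos H z)
    have h0 : χ z 0 = 1 ∨ χ z 0 = 0 := by
      have := h.add z 0 0
      rw [add_zero] at this
      by_cases h0 : χ z 0 = 0
      · exact Or.inr h0
      · left
        have : χ z 0 * (χ z 0 - 1) = 0 := by linarith
        rcases mul_eq_zero.1 this with h1 | h1
        · exact absurd h1 h0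
        · linarith
    rcases h0 with h0 | h0
    · rw [h0]; exact mul_le_mul_of_nonneg_left (h.le _ _) (h.q0 _)
    · have : χ z g = 0 := by
        have := h.add z 0 g
        rw [zero_add, h0, zero_mul] at this; exact this
      rw [h0, this]
  exact le_of_mul_le_mul_left h2 h.Npos

lemma SD.triples {χ : G → G → ℝ} {N : ℝ} {q : G → ℝ} (h : SD χ N q) :
    ∑ x, ∑ y, q x * q y * q (x + y) = N * ∑ x, q x ^ 3 := by
  have : N * ∑ x, ∑ y, q x * q y * q (x + y) = N * (N * ∑ x, q x ^ 3) := by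
    calc N * ∑ x, ∑ y, q x * q y * q (x + y)
        = ∑ x, ∑ y, ∑ z, q z * (q x * χ z x) * (q y * χ z y) := by
          simp only [mul_sum]
          refine sum_congr rfl fun x _ => sum_congr rfl fun y _ => ?_
          rw [show N * (q x * q y * q (x + y)) = q x * q y * (N * q (x + y)) by ring, ← h.ft,
            mul_sum]
          refine sum_congr rfl fun z _ => ?_
          rw [h.symm (x + y) z, h.add]; ring
      _ = ∑ z, q z * (∑ x, q x * χ z x) * (∑ y, q y * χ z y) := by
          rw [show ∑ x, ∑ y, ∑ z, q z * (q x * χ z x) * (q y * χ z y) =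
            ∑ x, ∑ z, ∑ y, q z * (q x * χ z x) * (q y * χ z y) from
              sum_congr rfl fun x _ => sum_comm, sum_comm]
          refine sum_congr rfl fun z _ => ?_
          rw [mul_assoc, sum_mul_sum, mul_sum]
          refine sum_congr rfl fun x _ => ?_
          rw [mul_sum]
          exact sum_congr rfl fun y _ => by ring
      _ = N * (N * ∑ x, q x ^ 3) := by
          simp only [h.ft, mul_sum]
          refine sum_congr rfl fun x _ => by ring
  exact mul_left_cancel₀ h.Npos.ne' this

lemma cube_ge {q : G → ℝ} (h0 : ∀ x, 0 ≤ q x) :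
    (∑ x, q x ^ 2) ^ 2 ≤ (∑ x, q x) * ∑ x, q x ^ 3 := by
  have := sum_mul_sq_le_sq_mul_sq univ (fun x => sqrt (q x)) (fun x => sqrt (q x) * q x)
  simp only [← mul_assoc, mul_self_sqrt (h0 _), mul_pow, sq_sqrt (h0 _)] at this
  calc _ = _ := by congr 1; exact sum_congr rfl fun x _ => by ring
    _ ≤ _ := this
    _ = _ := by congr 1; exact sum_congr rfl fun x _ => by ring

lemma supp_bound {μ : α → ℝ} (h : ∀ a, 0 ≤ μ a) (A : Finset α) (hA : ∀ a, μ a ≠ 0 → a ∈ A)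
    {t : ℝ} (ht : 0 < t) (hs : ∑ a, μ a = t) : S μ ≤ t * log A.card - t * log t := by
  have hAne : (0:ℝ) < A.card := by
    have : A.Nonempty := by
      by_contra hne
      rw [not_nonempty_iff_eq_empty] at hne
      have : ∀ a, μ a = 0 := by
        intro a; by_contra ha; have := hA a ha; simp [hne] at this
      simp [this] at hs; linarith
    exact_mod_cast this.card_pos
  have e : ∑ a, μ a = ∑ a ∈ A, μ a := (sum_subset (subset_univ A) fun a _ ha => by
    by_contra hne; exact ha (hA a hne)).symm
  have e' : S μ = ∑ a ∈ A, negMulLog (μ a) := (sum_subset (subset_univ A) fun a _ ha => by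
    have : μ a = 0 := by by_contra hne; exact ha (hA a hne)
    simp [this]).symm
  rw [e'] 
  have pt : ∀ a ∈ A, negMulLog (μ a) ≤ μ a * (log A.card - log t) + (t / A.card - μ a) := by
    intro a _
    rcases (h a).eq_or_lt with h0 | h0
    · rw [← h0]; simp; positivity
    · have := log_le_sub_one_of_pos (show 0 < t / (A.card * μ a) by positivity)
      rw [log_div ht.ne' (by positivity), log_mul hAne.ne' h0.ne'] at this
      have h2 := mul_le_mul_of_nonneg_left this h0.le
      have h3 : μ a * (t / (A.card * μ a) - 1) = t / A.card - μ a := by field_simp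
      rw [h3] at h2
      rw [negMulLog]; linarith
  refine (sum_le_sum pt).trans (le_of_eq ?_)
  rw [sum_add_distrib, sum_sub_distrib, ← sum_mul, ← e, hs]
  simp
  field_simp
  ring

/-- indicator function -/
def ind (A : Finset α) (x : α) : ℝ := if x ∈ A then 1 else 0

lemma ind_nonneg (A : Finset α) (x : α) : 0 ≤ ind A x := by unfold ind; split_ifs <;> simp

lemma sum_ind (A : Finset α) : ∑ x, ind A x = A.card := by simp [ind]

lemma S_ind (A : Finset α) : S (ind A) = 0 := by
  rw [S]
  refine sum_eq_zero fun x _ => ?_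
  unfold ind; split_ifs <;> simp

/-- uniform measure -/
def unif (A : Finset α) (x : α) : ℝ := (A.card : ℝ)⁻¹ * ind A x

lemma unif_Pr {A : Finset α} (h : (0:ℝ) < A.card) : Pr (unif A) := by
  refine ⟨fun x => mul_nonneg (inv_nonneg.2 h.le) (ind_nonneg _ _), ?_⟩
  simp only [unif, ← mul_sum, sum_ind]
  exact inv_mul_cancel₀ h.ne'

lemma S_unif {A : Finset α} (h : (0:ℝ) < A.card) : S (unif A) = log A.card := by
  simp only [S, unif, ind, mul_ite, mul_one, mul_zero]
  rw [show ∑ a, negMulLog (if a ∈ A then (A.card:ℝ)⁻¹ else 0) =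
    ∑ a, (if a ∈ A then negMulLog (A.card:ℝ)⁻¹ else 0) from
    sum_congr rfl fun a _ => by split_ifs <;> simp]
  simp [negMulLog]
  field_simp

lemma D_unif {A : Finset G} (h : (0:ℝ) < A.card) :
    D (ind A) (ind A) = (A.card : ℝ) * A.card * D (unif A) (unif A) := by
  rw [← D_smul]
  have : (fun g => (A.card:ℝ) * unif A g) = ind A := by
    funext g; simp [unif, mul_inv_cancel_left₀ h.ne']
  rw [this]

lemma char_two (hG : ∀ x : G, x + x = 0) {x y z : G} : x + y = z ↔ y = x + z := by
  constructor
  · rintro rfl; rw [← add_assoc, hG, zero_add]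
  · rintro rfl; rw [← add_assoc, hG, zero_add]

lemma bsg_set (hG : ∀ x : G, x + x = 0) (A : Finset G) {t L : ℝ}
    (ht : t = ((univ : Finset (G × G)).filter (fun s => s.1 ∈ A ∧ s.2 ∈ A ∧ s.1 + s.2 ∈ A)).card)
    (ht0 : 0 < t) (hL : 0 < L) (hLb : 6 * log A.card - 3 * log t ≤ L) :
    ∃ z, t / (2 * A.card) ≤ (A.filter (fun x => x + z ∈ A)).card ∧
      D (unif (A.filter (fun x => x + z ∈ A))) (unif (A.filter (fun x => x + z ∈ A))) ≤ 2 * L := by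
  set T := (univ : Finset (G × G)).filter (fun s => s.1 ∈ A ∧ s.2 ∈ A ∧ s.1 + s.2 ∈ A) with hT
  have memT : ∀ s, s ∈ T ↔ s.1 ∈ A ∧ s.2 ∈ A ∧ s.1 + s.2 ∈ A := by intro s; simp [hT]
  have hw : ∀ s, 0 ≤ ind T s := ind_nonneg T
  have hsum : ∑ s, ind T s = t := by rw [sum_ind, ht]
  have hAne : A.Nonempty := by
    have : T.Nonempty := by
      rw [ht] at ht0
      exact card_pos.1 (by exact_mod_cast ht0)
    obtain ⟨s, hs⟩ := this
    exact ⟨s.1, ((memT s).1 hs).1⟩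
  have hA0 : (0:ℝ) < A.card := by exact_mod_cast hAne.card_pos
  have b := bsg hG hw
  have bd : ∀ X : G × G → G, (∀ s ∈ T, X s ∈ A) → En (ind T) X ≤ t * log A.card - t * log t := by
    intro X hX
    refine supp_bound (P_nonneg hw X) A ?_ ht0 (by rw [sum_P, hsum])
    intro a ha
    by_contra hna
    apply ha
    refine sum_eq_zero fun s _ => ?_
    split_ifs with h
    · unfold ind
      rw [if_neg]
      intro hs
      exact hna (h ▸ hX s hs)
    · rfl
  have b1 := bd (fun s => s.1) fun s hs => ((memT s).1 hs).1
  have b2 := bd (fun s => s.2) fun s hs => ((memT s).1 hs).2.1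
  have b3 := bd (fun s => s.1 + s.2) fun s hs => ((memT s).1 hs).2.2
  set Az : G → Finset G := fun z => A.filter (fun x => x + z ∈ A) with hAz
  have pz : ∀ z, P (ind T) (fun s => s.1 + s.2) z = if z ∈ A then ((Az z).card : ℝ) else 0 := by
    intro z
    simp only [P, Fintype.sum_prod_type, char_two hG]
    rw [show ∑ x, ∑ y, (if y = x + z then ind T (x, y) else 0) = ∑ x, ind T (x, x + z) from
      sum_congr rfl fun x _ => by simp]
    have : ∀ x, ind T (x, x + z) = if z ∈ A then ind (Az z) x else 0 := by
      intro x
      simp only [ind, memT, hAz, mem_filter]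
      rw [show x + (x + z) = z by rw [← add_assoc, hG, zero_add]]
      by_cases hz : z ∈ A <;> simp [hz]
    simp only [this]
    split_ifs
    · rw [sum_ind]
    · simp
  have s1 : ∀ z ∈ A, sl (ind T) (fun s => s.1) (fun s => s.1 + s.2) z = ind (Az z) := by
    intro z hz
    funext a
    simp only [sl, P, Fintype.sum_prod_type, Prod.mk.injEq, ite_and, char_two hG]
    rw [sum_eq_single a (fun x _ hx => by simp [hx]) (by simp)]
    simp only [if_true, sum_ite_eq', mem_univ]
    simp only [ind, memT, hAz, mem_filter]
    rw [show a + (a + z) = z by rw [← add_assoc, hG, zero_add]]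
    simp [hz]
  have s2 : ∀ z ∈ A, sl (ind T) (fun s => s.2) (fun s => s.1 + s.2) z = ind (Az z) := by
    intro z hz
    funext a
    simp only [sl, P, Fintype.sum_prod_type, Prod.mk.injEq, ite_and]
    rw [sum_comm, sum_eq_single a (fun x _ hx => by simp [hx]) (by simp)]
    simp only [if_true, add_comm _ a, char_two hG, sum_ite_eq', mem_univ]
    simp only [ind, memT, hAz, mem_filter]
    rw [show a + z + a = z by rw [add_comm a z, add_assoc, hG, add_zero]]
    simp only [hz, and_true]
    simp only [and_comm]
  by_contra! hcon
  have hsumA : ∑ z ∈ A, ((Az z).card : ℝ) = t := by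
    rw [← hsum, ← sum_P _ (fun s : G × G => s.1 + s.2)]
    simp only [pz]
    simp
  have hterm : ∀ z ∈ A, 2 * L * ((Az z).card - t / (2 * A.card)) <
      (P (ind T) (fun s => s.1 + s.2) z)⁻¹ * D (sl (ind T) (fun s => s.1) (fun s => s.1 + s.2) z)
        (sl (ind T) (fun s => s.2) (fun s => s.1 + s.2) z) := by
    intro z hz
    rw [pz, if_pos hz, s1 z hz, s2 z hz]
    have hpos : 0 < t / (2 * (A.card : ℝ)) := by positivity
    rcases Nat.eq_zero_or_pos (Az z).card with h0 | h0
    · rw [h0]; simp; positivity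
    · have h0' : (0:ℝ) < (Az z).card := by exact_mod_cast h0
      have hu := unif_Pr h0'
      rw [D_unif h0', show ((Az z).card : ℝ)⁻¹ * ((Az z).card * (Az z).card *
        D (unif (Az z)) (unif (Az z))) = (Az z).card * D (unif (Az z)) (unif (Az z)) by field_simp]
      by_cases hc : t / (2 * A.card) ≤ (Az z).card
      · have := hcon z hc
        have h2 := mul_lt_mul_of_pos_left this h0'
        have : 0 < 2 * L * (t / (2 * A.card)) := by positivity
        linarith
      · push Not at hc
        have h3 : 0 ≤ (Az z).card * D (unif (Az z)) (unif (Az z)) :=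
          mul_nonneg h0'.le (D_nonneg hu hu)
        have h4 : 2 * L * ((Az z).card - t / (2 * A.card)) < 0 :=
          mul_neg_of_pos_of_neg (by linarith) (by linarith)
        linarith
  have hlt := sum_lt_sum_of_nonempty hAne hterm
  rw [← mul_sum, sum_sub_distrib, hsumA] at hlt
  have hrest : ∑ z ∈ A, (P (ind T) (fun s => s.1 + s.2) z)⁻¹ *
        D (sl (ind T) (fun s => s.1) (fun s => s.1 + s.2) z)
        (sl (ind T) (fun s => s.2) (fun s => s.1 + s.2) z) =
      ∑ z, (P (ind T) (fun s => s.1 + s.2) z)⁻¹ *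
        D (sl (ind T) (fun s => s.1) (fun s => s.1 + s.2) z)
        (sl (ind T) (fun s => s.2) (fun s => s.1 + s.2) z) :=
    sum_subset (subset_univ A) fun z _ hz => by rw [pz, if_neg hz]; simp
  rw [hrest] at hlt
  rw [S_ind, hsum, negMulLog] at b
  have e1 : ∑ z ∈ A, t / (2 * (A.card : ℝ)) = t / 2 := by
    simp; field_simp
  rw [e1] at hlt
  have := mul_le_mul_of_nonneg_left hLb ht0.le
  nlinarith

/-- the constant -/
def c0 : ℝ := (373248 : ℝ)⁻¹ ^ 408

lemma c0_pos : 0 < c0 := by unfold c0; positivity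

/-- the constant of stage one -/
def c1 : ℝ := c0 / 144

lemma c1_pos : 0 < c1 := div_pos c0_pos (by norm_num)

lemma stage1 (hG : ∀ x : G, x + x = 0) {χ : G → G → ℝ} {N δ : ℝ} {q : G → ℝ} (h : SD χ N q)
    (hδ : 0 < δ) (hδ1 : δ ≤ 1) (h2 : δ * N ≤ ∑ x, q x ^ 2) :
    ∃ H : AddSubgroup G, c1 * δ ^ 7350 * N ≤ ∑ x, (if x ∈ H then q x else 0) ∧
      c1 * δ ^ 7350 * cd H ≤ N := by
  have hN := h.Npos
  have h3 : δ ^ 2 * N ≤ ∑ x, q x ^ 3 := by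
    have a := cube_ge h.q0
    have c3 : 0 ≤ ∑ x, q x ^ 3 := sum_nonneg fun x _ => pow_nonneg (h.q0 x) 3
    have b : (δ * N) ^ 2 ≤ (∑ x, q x ^ 2) ^ 2 := by gcongr
    have d := mul_le_mul_of_nonneg_right h.qsum c3
    have : N * (δ ^ 2 * N) ≤ N * ∑ x, q x ^ 3 := by nlinarith
    exact le_of_mul_le_mul_left this hN
  set θ := δ ^ 2 / 6 with hθ
  have hθ0 : 0 < θ := by positivity
  set A : Finset G := univ.filter (fun x => θ ≤ q x) with hA
  have memA : ∀ x, x ∈ A ↔ θ ≤ q x := by intro x; simp [hA]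
  set T := (univ : Finset (G × G)).filter (fun s => s.1 ∈ A ∧ s.2 ∈ A ∧ s.1 + s.2 ∈ A) with hT
  have hAcard : θ * A.card ≤ N := by
    refine le_trans ?_ h.qsum
    rw [← sum_ind, mul_sum]
    refine sum_le_sum fun x _ => ?_
    unfold ind
    split_ifs with hx
    · rw [mul_one]; exact (memA x).1 hx
    · rw [mul_zero]; exact h.q0 x
  have hTcard : δ ^ 2 * N ^ 2 / 2 ≤ T.card := by
    have pt : ∀ x y, q x * q y * q (x + y) ≤ ind T (x, y) +
        θ * (q x * q y + q y * q (x + y) + q x * q (x + y)) := by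
      intro x y
      have x0 := h.q0 x
      have y0 := h.q0 y
      have z0 := h.q0 (x + y)
      have x1 := h.q1 x
      have y1 := h.q1 y
      have z1 := h.q1 (x + y)
      have xy := mul_nonneg x0 y0
      have yz := mul_nonneg y0 z0
      have xz := mul_nonneg x0 z0
      have pos : 0 ≤ θ * (q x * q y + q y * q (x + y) + q x * q (x + y)) := by positivity
      unfold ind
      split_ifs with hs
      · have : q x * q y * q (x + y) ≤ 1 := by
          have : q x * q y ≤ 1 := by nlinarith
          nlinarith
        linarith
      · have : q x < θ ∨ q y < θ ∨ q (x + y) < θ := by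
          by_contra! hc
          apply hs
          simp only [hT, mem_filter, mem_univ, true_and, memA]
          exact hc
        rw [zero_add]
        have p1 : 0 ≤ θ * (q x * q y) := by positivity
        have p2 : 0 ≤ θ * (q y * q (x + y)) := by positivity
        have p3 : 0 ≤ θ * (q x * q (x + y)) := by positivity
        rcases this with hl | hl | hl
        · have := mul_le_mul_of_nonneg_right hl.le yz
          linarith
        · have := mul_le_mul_of_nonneg_right hl.le xz
          linarith
        · have := mul_le_mul_of_nonneg_right hl.le xy
          linarith
    have hs := sum_le_sum fun x (_ : x ∈ univ) => sum_le_sum fun y (_ : y ∈ univ) => pt x y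
    rw [h.triples] at hs
    simp only [sum_add_distrib, ← mul_sum] at hs
    have eT : ∑ x, ∑ y, ind T (x, y) = T.card := by
      rw [← sum_ind, Fintype.sum_prod_type]
    have sh : ∀ x, ∑ y, q (x + y) = ∑ y, q y := fun x => Equiv.sum_comp (Equiv.addLeft x) q
    have e1 : ∑ x, q x * ∑ y, q y = (∑ x, q x) * ∑ y, q y := by rw [sum_mul]
    have e2 : ∑ x, ∑ y, q y * q (x + y) = (∑ x, q x) * ∑ y, q y := by
      rw [sum_comm, sum_mul]
      refine sum_congr rfl fun y _ => ?_
      rw [← mul_sum, sum_shift q y]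
    have e3 : ∑ x, q x * ∑ y, q (x + y) = (∑ x, q x) * ∑ y, q y := by
      simp only [sh]; rw [sum_mul]
    rw [eT, e1, e2, e3] at hs
    have q0 : 0 ≤ ∑ x, q x := sum_nonneg fun x _ => h.q0 x
    have : (∑ x, q x) * ∑ y, q y ≤ N * N := mul_le_mul h.qsum h.qsum q0 hN.le
    have := mul_le_mul_of_nonneg_left this hθ0.le
    have hh := mul_le_mul_of_nonneg_left h3 hN.le
    have e4 : θ * (N * N) = δ ^ 2 * N ^ 2 / 6 := by rw [hθ]; ring
    nlinarith
  obtain ⟨t, ht⟩ : ∃ t : ℝ, t = (T.card : ℝ) := ⟨_, rfl⟩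
  rw [← ht] at hTcard
  have ht0 : 0 < t := lt_of_lt_of_le (by positivity) hTcard
  have hA0 : (0:ℝ) < A.card := by
    have : T.Nonempty := card_pos.1 (by rw [ht] at ht0; exact_mod_cast ht0)
    obtain ⟨s, hs⟩ := this
    have : s.1 ∈ A := by
      simp only [hT, mem_filter] at hs
      exact hs.2.1
    exact_mod_cast card_pos.2 ⟨_, this⟩
  have hAle : (A.card : ℝ) ≤ 6 * N / δ ^ 2 := by
    rw [le_div_iff₀ (by positivity)]
    rw [hθ] at hAcard; linarith
  set L := log (373248 / δ ^ 18) with hL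
  have hL0 : 0 < L := by
    apply log_pos
    rw [lt_div_iff₀ (by positivity)]
    have : δ ^ 18 ≤ 1 := pow_le_one₀ hδ.le hδ1
    linarith
  have hLb : 6 * log A.card - 3 * log t ≤ L := by
    have l1 : log A.card ≤ log (6 * N / δ ^ 2) := log_le_log hA0 hAle
    have l2 : log (δ ^ 2 * N ^ 2 / 2) ≤ log t := log_le_log (by positivity) hTcard
    have : 6 * log (6 * N / δ ^ 2) - 3 * log (δ ^ 2 * N ^ 2 / 2) = L := by
      rw [hL, show (6:ℝ) = (6:ℕ) by norm_num, show (3:ℝ) = (3:ℕ) by norm_num, ← log_pow, ← log_pow,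
        ← log_div (by positivity) (by positivity)]
      congr 1
      field_simp
      norm_num
    linarith
  obtain ⟨z, hz1, hz2⟩ := bsg_set hG A ht ht0 hL0 hLb
  set B := A.filter (fun x => x + z ∈ A) with hB
  have hB0 : (0:ℝ) < B.card := lt_of_lt_of_le (by positivity) hz1
  obtain ⟨H, g, hm, hc⟩ := pfr hG (unif_Pr hB0)
  rw [S_unif hB0] at hc
  set e := exp (-(408 * L)) with he
  have he0 : 0 < e := exp_pos _
  have heq : e = c0 * δ ^ 7344 := by
    rw [c0, he, hL, exp_neg, show 408 * log (373248 / δ ^ 18) = log ((373248 / δ ^ 18) ^ 408) by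
      rw [log_pow]; norm_num, exp_log (by positivity), div_pow, inv_div, ← pow_mul, div_eq_mul_inv,
      inv_pow, mul_comm]
  have hBA : (B.card : ℝ) ≤ A.card := by exact_mod_cast card_le_card (filter_subset _ _)
  have hcd0 : 0 < cd H := by
    have : (1:ℝ) ≤ cd H := by
      have := single_le_sum (f := fun x => if x ∈ H then (1:ℝ) else 0) (s := univ)
        (fun x _ => by split_ifs <;> simp) (mem_univ 0)
      simpa [cd, H.zero_mem] using this
    linarith
  obtain ⟨d, hd⟩ : ∃ d, d = δ ^ 7344 := ⟨_, rfl⟩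
  have hd0 : 0 < d := by rw [hd]; positivity
  have h7350 : δ ^ 7350 = d * δ ^ 6 := by rw [hd, ← pow_add]
  have hc0 := c0_pos
  rw [← hd] at heq
  rw [h7350]
  refine ⟨H, ?_, ?_⟩
  · have m1 : e ≤ ∑ x, (if x + g ∈ H then unif B x else 0) := by
      refine le_trans ?_ hm
      apply exp_le_exp.2
      linarith
    have m2 : θ * B.card * e ≤ ∑ x, (if x + g ∈ H then q x else 0) := by
      calc θ * B.card * e ≤ θ * B.card * ∑ x, (if x + g ∈ H then unif B x else 0) := by gcongr
        _ ≤ _ := by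
          rw [mul_sum]
          refine sum_le_sum fun x _ => ?_
          split_ifs
          · unfold unif ind
            split_ifs with hx
            · have : θ ≤ q x := (memA x).1 (mem_filter.1 hx).1
              refine le_trans (le_of_eq ?_) this
              field_simp
            · rw [mul_zero, mul_zero]; exact h.q0 x
          · simp
    have m3 : ∑ x, (if x + g ∈ H then q x else 0) = ∑ x, (if x ∈ H then q (x + g) else 0) := by
      rw [← sum_shift _ g]
      refine sum_congr rfl fun x _ => ?_
      rw [show x + g + g = x by rw [add_assoc, hG, add_zero]]
    rw [m3] at m2
    refine le_trans ?_ (m2.trans (h.pd H g))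
    have m4 : δ ^ 4 * N / 24 ≤ B.card := by
      refine le_trans ?_ hz1
      rw [le_div_iff₀ (by positivity)]
      calc δ ^ 4 * N / 24 * (2 * A.card) ≤ δ ^ 4 * N / 24 * (2 * (6 * N / δ ^ 2)) := by gcongr
        _ = δ ^ 2 * N ^ 2 / 2 := by field_simp; norm_num
        _ ≤ t := hTcard
    calc c1 * (d * δ ^ 6) * N = θ * (δ ^ 4 * N / 24) * e := by rw [heq, hθ, c1]; ring
      _ ≤ _ := by gcongr
  · have m1 : cd H ≤ A.card * e⁻¹ := by
      rw [← log_le_log_iff hcd0 (by positivity), log_mul hA0.ne' (by positivity), log_inv, he,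
        log_exp]
      have := log_le_log hB0 hBA
      linarith
    calc c1 * (d * δ ^ 6) * cd H ≤ c1 * (d * δ ^ 6) * (6 * N / δ ^ 2 * e⁻¹) := by
          have hk : 0 ≤ c1 * (d * δ ^ 6) := mul_nonneg c1_pos.le (by positivity)
          have he1 : 0 ≤ e⁻¹ := inv_nonneg.2 he0.le
          exact mul_le_mul_of_nonneg_left (m1.trans (mul_le_mul_of_nonneg_right hAle he1)) hk
      _ = δ ^ 4 * N / 24 := by
          rw [heq, c1]; field_simp; norm_num
      _ ≤ N := by
          have : δ ^ 4 ≤ 1 := pow_le_one₀ hδ.le hδ1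
          nlinarith

end stageone
end U3I

namespace U3I
set_option linter.unusedSectionVars false

section fourier
open Finset
open scoped Classical

/-- the group -/
abbrev Vn (n : ℕ) := Fin n → ZMod 2

/-- sign -/
def sg (a : ZMod 2) : ℝ := if a = 0 then 1 else -1

lemma zmod2 (a : ZMod 2) : a = 0 ∨ a = 1 := by
  revert a; decide

lemma sg_zero : sg 0 = 1 := by simp [sg]
lemma sg_one : sg 1 = -1 := by simp [sg]

lemma sg_add (a b : ZMod 2) : sg (a + b) = sg a * sg b := by
  have h : (1 + 1 : ZMod 2) = 0 := by decide
  rcases zmod2 a with rfl | rfl <;> rcases zmod2 b with rfl | rfl <;>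
    simp [sg_zero, sg_one, h]

lemma sg_mul_self (a : ZMod 2) : sg a * sg a = 1 := by
  rcases zmod2 a with rfl | rfl <;> simp [sg_zero, sg_one]

lemma sg_le (a : ZMod 2) : sg a ≤ 1 := by
  rcases zmod2 a with rfl | rfl <;> norm_num [sg_zero, sg_one]

lemma sg_abs (a : ZMod 2) : ‖(sg a : ℂ)‖ = 1 := by
  rcases zmod2 a with rfl | rfl <;> simp [sg_zero, sg_one]

lemma sg_pow (a : ZMod 2) : (-1 : ℂ) ^ a.val = (sg a : ℂ) := by
  rcases zmod2 a with rfl | rfl <;> simp [sg_zero, sg_one, ZMod.val_one]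

lemma Vn_two {n : ℕ} (x : Vn n) : x + x = 0 := by
  funext i
  have : ∀ a : ZMod 2, a + a = 0 := by decide
  exact this _

lemma sum_sg_sub {G : Type} [Fintype G] [AddCommGroup G] (H : AddSubgroup G) (φ : G →+ ZMod 2) :
    ∑ x, (if x ∈ H then sg (φ x) else 0) =
      if ∀ x ∈ H, φ x = 0 then cd H else 0 := by
  split_ifs with h
  · rw [cd]
    refine sum_congr rfl fun x _ => ?_
    split_ifs with hx
    · rw [h x hx, sg_zero]
    · rfl
  · push Not at h
    obtain ⟨y, hy, hy1⟩ := h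
    have hy1' : φ y = 1 := (zmod2 _).resolve_left hy1
    have := sum_shift (fun x => if x ∈ H then sg (φ x) else 0) y
    have e : ∀ x, (if x + y ∈ H then sg (φ (x + y)) else 0) =
        -(if x ∈ H then sg (φ x) else 0) := by
      intro x
      rw [map_add, sg_add, hy1', sg_one]
      simp only [H.add_mem_cancel_right hy]
      split_ifs <;> ring
    simp only [e, sum_neg_distrib] at this
    linarith

variable {n : ℕ}

lemma orth (ξ : Vn n) : ∑ x : Vn n, sg (ξ ⬝ᵥ x) = if ξ = 0 then (Fintype.card (Vn n) : ℝ) else 0 := by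
  split_ifs with h
  · subst h; simp [sg_zero]
  · have : ∃ i, ξ i ≠ 0 := by
      by_contra! hc; exact h (funext hc)
    obtain ⟨i, hi⟩ := this
    have hi1 := (zmod2 _).resolve_left hi
    have := sum_shift (fun x => sg (ξ ⬝ᵥ x)) (Pi.single i 1)
    simp only [dotProduct_add, sg_add, dotProduct_single, hi1, mul_one, sg_one] at this
    simp only [mul_neg, mul_one, sum_neg_distrib] at this
    linarith

lemma orth' (ξ : Vn n) : ∑ x : Vn n, sg (x ⬝ᵥ ξ) = if ξ = 0 then (Fintype.card (Vn n) : ℝ) else 0 := by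
  rw [← orth]; exact sum_congr rfl fun x _ => by rw [dotProduct_comm]

/-- Fourier transform -/
def hat (g : Vn n → ℂ) (ξ : Vn n) : ℂ := ∑ x, g x * (sg (ξ ⬝ᵥ x) : ℂ)
/-- autocorrelation -/
def ac (g : Vn n → ℂ) (k : Vn n) : ℂ := ∑ x, g (x + k) * conj (g x)
/-- multiplicative derivative -/
def dl (f : Vn n → ℂ) (h : Vn n) (x : Vn n) : ℂ := f (x + h) * conj (f x)

lemma sum_shiftC {G : Type} [Fintype G] [AddCommGroup G] (F : G → ℂ) (y : G) :
    ∑ x, F (y + x) = ∑ x, F x := Equiv.sum_comp (Equiv.addLeft y) F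

lemma hat_sq (g : Vn n → ℂ) (ξ : Vn n) :
    (Complex.normSq (hat g ξ) : ℂ) = ∑ k, ac g k * (sg (ξ ⬝ᵥ k) : ℂ) := by
  rw [← Complex.mul_conj, hat, map_sum, mul_comm, sum_mul_sum]
  simp only [ac, sum_mul]
  rw [sum_comm (s := univ (α := Vn n)) (t := univ (α := Vn n))
    (f := fun k x => g (x + k) * conj (g x) * (sg (ξ ⬝ᵥ k) : ℂ))]
  refine sum_congr rfl fun y _ => ?_
  rw [← sum_shiftC _ y]
  refine sum_congr rfl fun k _ => ?_
  rw [dotProduct_add, sg_add, map_mul, Complex.conj_ofReal]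
  have : (sg (ξ ⬝ᵥ y) : ℂ) * sg (ξ ⬝ᵥ y) = 1 := by exact_mod_cast sg_mul_self _
  push_cast
  linear_combination (g (y + k) * conj (g y) * (sg (ξ ⬝ᵥ k) : ℂ)) * this

lemma hat_inv (g : Vn n → ℂ) (k : Vn n) :
    ∑ ξ, (Complex.normSq (hat g ξ) : ℂ) * (sg (ξ ⬝ᵥ k) : ℂ) = Fintype.card (Vn n) * ac g k := by
  simp only [hat_sq, sum_mul]
  rw [sum_comm]
  have : ∀ l, ∑ ξ : Vn n, ac g l * (sg (ξ ⬝ᵥ l) : ℂ) * (sg (ξ ⬝ᵥ k) : ℂ) =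
      if l + k = 0 then ac g l * Fintype.card (Vn n) else 0 := by
    intro l
    have h := orth' (l + k)
    have h' : ∑ ξ : Vn n, (sg (ξ ⬝ᵥ (l + k)) : ℂ) =
        if l + k = 0 then (Fintype.card (Vn n) : ℂ) else 0 := by
      have := congrArg (fun r : ℝ => (r : ℂ)) h
      push_cast at this
      rw [this]
      split_ifs <;> simp
    simp only [mul_assoc, ← mul_sum]
    rw [show ∑ ξ : Vn n, (sg (ξ ⬝ᵥ l) : ℂ) * (sg (ξ ⬝ᵥ k) : ℂ) =
      ∑ ξ : Vn n, (sg (ξ ⬝ᵥ (l + k)) : ℂ) from sum_congr rfl fun ξ _ => by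
        rw [dotProduct_add, sg_add]; push_cast; rfl, h']
    split_ifs <;> simp
  simp only [this]
  have hk : ∀ l : Vn n, l + k = 0 ↔ l = k := by
    intro l
    rw [add_comm, char_two Vn_two, add_zero]
  simp only [hk, sum_ite_eq', mem_univ, if_true]
  ring

lemma ac_zero (g : Vn n → ℂ) : ac g 0 = ((∑ x, Complex.normSq (g x) : ℝ) : ℂ) := by
  simp [ac, Complex.mul_conj]

lemma parseval (g : Vn n → ℂ) :
    ∑ ξ, Complex.normSq (hat g ξ) = Fintype.card (Vn n) * ∑ x, Complex.normSq (g x) := by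
  have := hat_inv g 0
  rw [ac_zero] at this
  simp only [dotProduct_zero, sg_zero] at this
  have h2 : ((∑ ξ, Complex.normSq (hat g ξ) : ℝ) : ℂ) =
      ((Fintype.card (Vn n) * ∑ x, Complex.normSq (g x) : ℝ) : ℂ) := by
    push_cast
    push_cast at this
    simpa using this
  exact_mod_cast h2

lemma four (g : Vn n → ℂ) :
    ∑ ξ, Complex.normSq (hat g ξ) ^ 2 = Fintype.card (Vn n) * ∑ k, Complex.normSq (ac g k) := by
  have h2 : ((∑ ξ, Complex.normSq (hat g ξ) ^ 2 : ℝ) : ℂ) =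
      ((Fintype.card (Vn n) * ∑ k, Complex.normSq (ac g k) : ℝ) : ℂ) := by
    push_cast
    calc ∑ ξ, (Complex.normSq (hat g ξ) : ℂ) ^ 2
        = ∑ ξ, ∑ k, (Complex.normSq (hat g ξ) : ℂ) * (sg (ξ ⬝ᵥ k) : ℂ) * conj (ac g k) := by
          refine sum_congr rfl fun ξ _ => ?_
          have : (Complex.normSq (hat g ξ) : ℂ) = conj (∑ k, ac g k * (sg (ξ ⬝ᵥ k) : ℂ)) := by
            rw [← hat_sq, Complex.conj_ofReal]
          rw [sq]
          nth_rewrite 2 [this]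
          rw [map_sum, mul_sum]
          refine sum_congr rfl fun k _ => ?_
          rw [map_mul, Complex.conj_ofReal]; ring
      _ = _ := by
          rw [sum_comm, mul_sum]
          refine sum_congr rfl fun k _ => ?_
          rw [← sum_mul, hat_inv, mul_assoc, Complex.mul_conj]
  exact_mod_cast h2

lemma ac_dl (f : Vn n → ℂ) (h k : Vn n) : ac (dl f h) k = ac (dl f k) h := by
  unfold ac dl
  refine sum_congr rfl fun x _ => ?_
  rw [add_right_comm x k h, map_mul, map_mul, Complex.conj_conj]
  ring

lemma norm_le_card {g : Vn n → ℂ} (hg : ∀ x, ‖g x‖ ≤ 1) (ξ : Vn n) :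
    ‖hat g ξ‖ ≤ Fintype.card (Vn n) := by
  refine (norm_sum_le _ _).trans ?_
  calc ∑ x, ‖g x * (sg (ξ ⬝ᵥ x) : ℂ)‖ ≤ ∑ x : Vn n, (1:ℝ) := by
        refine sum_le_sum fun x _ => ?_
        rw [norm_mul, sg_abs, mul_one]; exact hg x
    _ = _ := by simp

/-- the quadratic Fourier weight -/
def qf (f : Vn n → ℂ) (t : Vn n × Vn n) : ℝ :=
  Complex.normSq (hat (dl f t.1) t.2) / (Fintype.card (Vn n) : ℝ) ^ 2

/-- the symplectic character -/
def chi (z x : Vn n × Vn n) : ℝ := sg (z.2 ⬝ᵥ x.1 + x.2 ⬝ᵥ z.1)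

lemma dl_norm {f : Vn n → ℂ} (hf : ∀ x, ‖f x‖ ≤ 1) (h x : Vn n) : ‖dl f h x‖ ≤ 1 := by
  rw [dl, norm_mul, RCLike.norm_conj]
  exact mul_le_one₀ (hf _) (norm_nonneg _) (hf _)

lemma qf_SD {f : Vn n → ℂ} (hf : ∀ x, ‖f x‖ ≤ 1) : SD chi (Fintype.card (Vn n) : ℝ) (qf f) := by
  have hN : (0:ℝ) < Fintype.card (Vn n) := by exact_mod_cast Fintype.card_pos
  refine ⟨?_, ?_, fun z x => sg_le _, ?_, hN, ?_, ?_, ?_, ?_⟩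
  · intro x y
    simp only [chi]
    rw [add_comm]
  · intro z x y
    simp only [chi, Prod.fst_add, Prod.snd_add, dotProduct_add, add_dotProduct]
    rw [← sg_add]; congr 1; ring
  · intro H z
    let φ : Vn n × Vn n →+ ZMod 2 :=
      { toFun := fun x => z.2 ⬝ᵥ x.1 + x.2 ⬝ᵥ z.1
        map_zero' := by simp
        map_add' := by
          intro x y
          simp only [Prod.fst_add, Prod.snd_add, dotProduct_add, add_dotProduct]; ring }
    have := sum_sg_sub H φ
    have e : ∑ x, (if x ∈ H then chi z x else 0) = ∑ x, (if x ∈ H then sg (φ x) else 0) := rfl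
    rw [e, this]
    split_ifs
    · exact sum_nonneg fun x _ => by split_ifs <;> simp
    · exact le_rfl
  · intro t
    exact div_nonneg (Complex.normSq_nonneg _) (by positivity)
  · intro t
    rw [qf, div_le_one (by positivity), Complex.normSq_eq_norm_sq]
    have := norm_le_card (dl_norm hf t.1) t.2
    gcongr
  · rw [Fintype.sum_prod_type]
    simp only [qf, ← sum_div, parseval]
    rw [div_le_iff₀ (by positivity), ← mul_sum]
    have : ∑ h, ∑ x, Complex.normSq (dl f h x) ≤ ∑ h : Vn n, ∑ x : Vn n, (1:ℝ) := by
      refine sum_le_sum fun h _ => sum_le_sum fun x _ => ?_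
      rw [Complex.normSq_eq_norm_sq]
      exact pow_le_one₀ (norm_nonneg _) (dl_norm hf h x)
    simp only [sum_const, card_univ, nsmul_eq_mul, mul_one] at this
    nlinarith
  · rintro ⟨k, η⟩
    have key : ∑ h, ∑ ξ, (Complex.normSq (hat (dl f h) ξ) : ℂ) * (sg (η ⬝ᵥ h + ξ ⬝ᵥ k) : ℂ) =
        Fintype.card (Vn n) * (Complex.normSq (hat (dl f k) η) : ℂ) := by
      rw [hat_sq, mul_sum]
      refine sum_congr rfl fun h _ => ?_
      rw [ac_dl, ← mul_assoc, ← hat_inv, sum_mul]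
      refine sum_congr rfl fun ξ _ => ?_
      rw [sg_add]; push_cast; ring
    have key' : ∑ h, ∑ ξ, Complex.normSq (hat (dl f h) ξ) * sg (η ⬝ᵥ h + ξ ⬝ᵥ k) =
        Fintype.card (Vn n) * Complex.normSq (hat (dl f k) η) := by exact_mod_cast key
    rw [Fintype.sum_prod_type]
    simp only [qf, chi]
    rw [← mul_div_assoc, ← key', sum_div]
    refine sum_congr rfl fun h _ => ?_
    rw [sum_div]
    refine sum_congr rfl fun ξ _ => by ring

lemma qf_u3 (f : Vn n → ℂ) :
    ∑ t, qf f t ^ 2 = (Fintype.card (Vn n) : ℝ) * (u3Pow8 f).re := by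
  have hN : (Fintype.card (Vn n) : ℝ) ≠ 0 := by exact_mod_cast Fintype.card_ne_zero
  have e1 : ∑ t, qf f t ^ 2 = (∑ h, ∑ k, Complex.normSq (ac (dl f h) k)) *
      ((Fintype.card (Vn n) : ℝ)⁻¹ ^ 3) := by
    rw [Fintype.sum_prod_type, sum_mul]
    refine sum_congr rfl fun h _ => ?_
    simp only [qf, div_pow, ← sum_div, four]
    field_simp
  have e2 : ((∑ h, ∑ k, Complex.normSq (ac (dl f h) k) : ℝ) : ℂ) =
      ∑ x : Vn n, ∑ h₁ : Vn n, ∑ h₂ : Vn n, ∑ h₃ : Vn n,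
      f x * conj (f (x + h₁)) * conj (f (x + h₂)) * conj (f (x + h₃)) *
        f (x + h₁ + h₂) * f (x + h₁ + h₃) * f (x + h₂ + h₃) *
        conj (f (x + h₁ + h₂ + h₃)) := by
    push_cast
    rw [sum_comm (s := univ (α := Vn n)) (t := univ (α := Vn n)) (f := fun x h₁ => ∑ h₂ : Vn n, ∑ h₃ : Vn n,
      f x * conj (f (x + h₁)) * conj (f (x + h₂)) * conj (f (x + h₃)) *
        f (x + h₁ + h₂) * f (x + h₁ + h₃) * f (x + h₂ + h₃) *
        conj (f (x + h₁ + h₂ + h₃)))]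
    refine sum_congr rfl fun h _ => ?_
    rw [sum_comm]
    refine sum_congr rfl fun k _ => ?_
    rw [← Complex.mul_conj, ac, map_sum, sum_mul_sum]
    refine sum_congr rfl fun x _ => ?_
    rw [← sum_shiftC _ x]
    refine sum_congr rfl fun l _ => ?_
    simp only [dl, map_mul, Complex.conj_conj]
    rw [add_right_comm x k h, add_right_comm x l k, add_right_comm (x + k) l h,
      add_right_comm x k h, add_right_comm x l h]
    ring
  have e3 : (u3Pow8 f).re = (Fintype.card (Vn n) : ℝ)⁻¹ ^ 4 *
      (∑ h, ∑ k, Complex.normSq (ac (dl f h) k)) := by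
    rw [u3Pow8, ← e2, show ((Fintype.card (Vn n) : ℂ))⁻¹ ^ 4 =
      (((Fintype.card (Vn n) : ℝ)⁻¹ ^ 4 : ℝ) : ℂ) by push_cast; rfl, Complex.re_ofReal_mul,
      Complex.ofReal_re]
  rw [e1, e3]
  field_simp

end fourier
end U3I

namespace U3I
set_option linter.unusedSectionVars false

section stagetwo
open Finset
open scoped Classical

variable {n : ℕ}

lemma qf_row {f : Vn n → ℂ} (hf : ∀ x, ‖f x‖ ≤ 1) (h : Vn n) : ∑ ξ, qf f (h, ξ) ≤ 1 := by
  have hN : (0:ℝ) < Fintype.card (Vn n) := by exact_mod_cast Fintype.card_pos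
  simp only [qf, ← sum_div, parseval]
  rw [div_le_one (by positivity)]
  have : ∑ x, Complex.normSq (dl f h x) ≤ ∑ x : Vn n, (1:ℝ) := by
    refine sum_le_sum fun x _ => ?_
    rw [Complex.normSq_eq_norm_sq]
    exact pow_le_one₀ (norm_nonneg _) (dl_norm hf h x)
  simp only [sum_const, card_univ, nsmul_eq_mul, mul_one] at this
  nlinarith

/-- positive definiteness on a graph -/
lemma graph_pd {f : Vn n → ℂ} (hf : ∀ x, ‖f x‖ ≤ 1) (M : Vn n →ₗ[ZMod 2] Vn n)
    (U : AddSubgroup (Vn n)) (a b : Vn n) :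
    ∑ h, (if h ∈ U then qf f (h + a, M h + b) else 0) ≤
      ∑ h, (if h ∈ U then qf f (h, M h) else 0) := by
  let Γ : AddSubgroup (Vn n × Vn n) :=
    { carrier := {t | t.1 ∈ U ∧ t.2 = M t.1}
      add_mem' := by
        rintro ⟨x, y⟩ ⟨x', y'⟩ ⟨h1, h2⟩ ⟨h1', h2'⟩
        refine ⟨U.add_mem h1 h1', ?_⟩
        simp only [] at h2 h2'
        simp [h2, h2']
      zero_mem' := ⟨U.zero_mem, by simp⟩
      neg_mem' := by
        rintro ⟨x, y⟩ ⟨h1, h2⟩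
        refine ⟨U.neg_mem h1, ?_⟩
        simp only [] at h2
        simp [h2] }
  have hΓ : ∀ x y, (x, y) ∈ Γ ↔ x ∈ U ∧ y = M x := fun x y => Iff.rfl
  have := (qf_SD hf).pd Γ (a, b)
  simp only [Fintype.sum_prod_type, hΓ, ite_and, Prod.mk_add_mk] at this
  have e : ∀ (F : Vn n → Vn n → ℝ), ∑ x, ∑ y, (if x ∈ U then if y = M x then F x y else 0 else 0) =
      ∑ x, (if x ∈ U then F x (M x) else 0) := by
    intro F
    refine sum_congr rfl fun x _ => ?_
    split_ifs
    · simp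
    · simp
  rw [e (fun x y => qf f (x + a, y + b)), e (fun x y => qf f (x, y))] at this
  exact this

lemma exists_M {f : Vn n → ℂ} (hf : ∀ x, ‖f x‖ ≤ 1) {γ : ℝ} (hγ : 0 < γ)
    (H : AddSubgroup (Vn n × Vn n))
    (h1 : γ * (Fintype.card (Vn n) : ℝ) ≤ ∑ x, (if x ∈ H then qf f x else 0))
    (h2 : γ * cd H ≤ (Fintype.card (Vn n) : ℝ)) :
    ∃ M : Vn n →ₗ[ZMod 2] Vn n, γ ^ 3 * (Fintype.card (Vn n) : ℝ) ≤ ∑ h, qf f (h, M h) := by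
  have hN : (0:ℝ) < Fintype.card (Vn n) := by exact_mod_cast Fintype.card_pos
  set Hs : Submodule (ZMod 2) (Vn n × Vn n) := AddSubgroup.toZModSubmodule 2 H with hHs
  have memHs : ∀ x, x ∈ Hs ↔ x ∈ H := fun x => by simp [hHs]
  let φ : Hs →ₗ[ZMod 2] Vn n := (LinearMap.fst (ZMod 2) (Vn n) (Vn n)).comp Hs.subtype
  obtain ⟨s, hs⟩ := LinearMap.exists_rightInverse_of_surjective φ.rangeRestrict
    (LinearMap.range_rangeRestrict φ)
  obtain ⟨M, hM⟩ := LinearMap.exists_extend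
    (((LinearMap.snd (ZMod 2) (Vn n) (Vn n)).comp Hs.subtype).comp s)
  set U : AddSubgroup (Vn n) := (LinearMap.range φ).toAddSubgroup with hU
  have memU : ∀ h, h ∈ U → (h, M h) ∈ H := by
    intro h hh
    have hh' : h ∈ LinearMap.range φ := hh
    have a1 : M h = ((s ⟨h, hh'⟩ : Hs) : Vn n × Vn n).2 := LinearMap.congr_fun hM ⟨h, hh'⟩
    have a2 : h = ((s ⟨h, hh'⟩ : Hs) : Vn n × Vn n).1 := by
      have := LinearMap.congr_fun hs ⟨h, hh'⟩
      exact (congrArg Subtype.val this).symm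
    have a3 := (s ⟨h, hh'⟩ : Hs).2
    rw [memHs] at a3
    have : (h, M h) = ((s ⟨h, hh'⟩ : Hs) : Vn n × Vn n) := Prod.ext a2 a1
    rw [this]; exact a3
  have memU' : ∀ h ξ, (h, ξ) ∈ H → h ∈ U := by
    intro h ξ hh
    exact ⟨⟨(h, ξ), (memHs _).2 hh⟩, rfl⟩
  have key : ∀ h ξ, (h, M h + ξ) ∈ H ↔ h ∈ U ∧ ((0 : Vn n), ξ) ∈ H := by
    intro h ξ
    constructor
    · intro hh
      have hu := memU' _ _ hh
      refine ⟨hu, ?_⟩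
      have := H.sub_mem hh (memU h hu)
      simpa using this
    · rintro ⟨hu, hx⟩
      have := H.add_mem (memU h hu) hx
      simpa using this
  have reform : ∀ F : Vn n × Vn n → ℝ, ∑ x, (if x ∈ H then F x else 0) =
      ∑ ξ, (if ((0 : Vn n), ξ) ∈ H then ∑ h, (if h ∈ U then F (h, M h + ξ) else 0) else 0) := by
    intro F
    rw [Fintype.sum_prod_type]
    have : ∀ h, ∑ ξ, (if (h, ξ) ∈ H then F (h, ξ) else 0) =
        ∑ ξ, (if (h, M h + ξ) ∈ H then F (h, M h + ξ) else 0) := fun h =>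
      (Equiv.sum_comp (Equiv.addLeft (M h)) (fun ξ => if (h, ξ) ∈ H then F (h, ξ) else 0)).symm
    simp only [this]
    rw [sum_comm]
    refine sum_congr rfl fun ξ _ => ?_
    split_ifs with hx
    · refine sum_congr rfl fun h _ => ?_
      simp [key, hx]
    · refine sum_eq_zero fun h _ => ?_
      simp [key, hx]
  set k : ℝ := ∑ ξ, (if ((0 : Vn n), ξ) ∈ H then (1:ℝ) else 0) with hk
  set u : ℝ := ∑ h, (if h ∈ U then (1:ℝ) else 0) with hu
  set σ : ℝ := ∑ h, (if h ∈ U then qf f (h, M h) else 0) with hσ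
  have q0 := (qf_SD hf).q0
  have i1 : ∑ x, (if x ∈ H then qf f x else 0) ≤ k * σ := by
    rw [reform, hk, sum_mul]
    refine sum_le_sum fun ξ _ => ?_
    split_ifs
    · have := graph_pd hf M U 0 ξ
      simp only [add_zero] at this
      rw [one_mul]; exact this
    · simp
  have i2 : ∑ x, (if x ∈ H then qf f x else 0) ≤ u := by
    rw [Fintype.sum_prod_type]
    refine sum_le_sum fun h _ => ?_
    split_ifs with hh
    · refine le_trans (sum_le_sum fun ξ _ => ?_) (qf_row hf h)
      split_ifs
      · exact le_rfl
      · exact q0 _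
    · refine le_of_eq (sum_eq_zero fun ξ _ => ?_)
      rw [if_neg fun hx => hh (memU' _ _ hx)]
  have i3 : cd H = k * u := by
    rw [cd, reform, hk, sum_mul]
    refine sum_congr rfl fun ξ _ => ?_
    split_ifs <;> simp [hu]
  have k0 : 0 ≤ k := sum_nonneg fun ξ _ => by split_ifs <;> simp
  have σ0 : 0 ≤ σ := sum_nonneg fun ξ _ => by split_ifs <;> simp [q0]
  refine ⟨M, ?_⟩
  have i4 : σ ≤ ∑ h, qf f (h, M h) := by
    refine sum_le_sum fun h _ => ?_
    split_ifs
    · exact le_rfl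
    · exact q0 _
  refine le_trans ?_ i4
  rw [i3] at h2
  have i5 : γ ^ 2 * k ≤ 1 := by
    have a : γ * Fintype.card (Vn n) ≤ u := h1.trans i2
    have b := mul_le_mul_of_nonneg_left a (mul_nonneg hγ.le k0)
    have : (γ ^ 2 * k) * Fintype.card (Vn n) ≤ 1 * Fintype.card (Vn n) := by nlinarith
    exact le_of_mul_le_mul_right this hN
  have i6 := mul_le_mul_of_nonneg_left (h1.trans i1) (sq_nonneg γ)
  have i7 := mul_le_mul_of_nonneg_right i5 σ0
  nlinarith

/-- the radical of the antisymmetrisation -/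
def radR (M : Vn n →ₗ[ZMod 2] Vn n) : AddSubgroup (Vn n) where
  carrier := {h | ∀ k, M h ⬝ᵥ k = M k ⬝ᵥ h}
  add_mem' := by
    intro a b ha hb k
    rw [map_add, add_dotProduct, dotProduct_add, ha k, hb k]
  zero_mem' := by intro k; simp
  neg_mem' := by
    intro a ha k
    rw [map_neg, neg_dotProduct, dotProduct_neg, ha k]

lemma mem_radR (M : Vn n →ₗ[ZMod 2] Vn n) (h : Vn n) :
    h ∈ radR M ↔ ∀ k, M h ⬝ᵥ k = M k ⬝ᵥ h := Iff.rfl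

lemma z2_add_eq_zero {a b : ZMod 2} : a + b = 0 ↔ a = b := by
  revert a b; decide

lemma gauss (M : Vn n →ₗ[ZMod 2] Vn n) (s ξ : Vn n) :
    (∑ h, sg (M h ⬝ᵥ (h + s)) * sg (ξ ⬝ᵥ h)) ^ 2 ≤ (Fintype.card (Vn n) : ℝ) * cd (radR M) := by
  set φ : Vn n → ZMod 2 := fun h => M h ⬝ᵥ (h + s) + ξ ⬝ᵥ h with hφ
  have e0 : ∀ h, sg (M h ⬝ᵥ (h + s)) * sg (ξ ⬝ᵥ h) = sg (φ h) := fun h => (sg_add _ _).symm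
  simp only [e0]
  have e1 : (∑ h, sg (φ h)) ^ 2 = ∑ k, sg (φ k) * ∑ h, sg (M h ⬝ᵥ k + M k ⬝ᵥ h) := by
    rw [sq, sum_mul_sum]
    have : ∀ h, ∑ j, sg (φ h) * sg (φ j) = ∑ k, sg (φ h) * sg (φ (h + k)) := fun h =>
      (Equiv.sum_comp (Equiv.addLeft h) (fun j => sg (φ h) * sg (φ j))).symm
    simp only [this]
    rw [sum_comm]
    refine sum_congr rfl fun k _ => ?_
    rw [mul_sum]
    refine sum_congr rfl fun h _ => ?_
    rw [← sg_add, ← sg_add]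
    congr 1
    simp only [hφ, map_add, dotProduct_add, add_dotProduct]
    have : ∀ a : ZMod 2, a + a = 0 := by decide
    linear_combination this (M h ⬝ᵥ h) + this (M h ⬝ᵥ s) + this (ξ ⬝ᵥ h)
  rw [e1, cd, mul_sum]
  refine sum_le_sum fun k _ => ?_
  let ψ : Vn n →+ ZMod 2 :=
    { toFun := fun h => M h ⬝ᵥ k + M k ⬝ᵥ h
      map_zero' := by simp
      map_add' := by
        intro x y
        simp only [map_add, dotProduct_add, add_dotProduct]; ring }
  have e2 : ∑ h, sg (M h ⬝ᵥ k + M k ⬝ᵥ h) =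
      if ∀ x ∈ (⊤ : AddSubgroup (Vn n)), ψ x = 0 then cd (⊤ : AddSubgroup (Vn n)) else 0 := by
    rw [← sum_sg_sub ⊤ ψ]
    refine sum_congr rfl fun h _ => ?_
    simp [ψ]
  have e3 : cd (⊤ : AddSubgroup (Vn n)) = Fintype.card (Vn n) := by simp [cd]
  have e4 : (∀ x ∈ (⊤ : AddSubgroup (Vn n)), ψ x = 0) ↔ k ∈ radR M := by
    rw [mem_radR]
    simp only [AddSubgroup.mem_top, true_imp_iff]
    refine forall_congr' fun x => ?_
    change M x ⬝ᵥ k + M k ⬝ᵥ x = 0 ↔ _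
    rw [z2_add_eq_zero, eq_comm]
  rw [e2, e3]
  simp only [e4]
  split_ifs
  · have : (0:ℝ) ≤ Fintype.card (Vn n) := by positivity
    nlinarith [sg_le (φ k)]
  · simp

lemma rad_large {f : Vn n → ℂ} (hf : ∀ x, ‖f x‖ ≤ 1) (M : Vn n →ₗ[ZMod 2] Vn n) :
    (∑ h, qf f (h, M h)) ^ 2 ≤ (Fintype.card (Vn n) : ℝ) * cd (radR M) := by
  have hN : (0:ℝ) < Fintype.card (Vn n) := by exact_mod_cast Fintype.card_pos
  set N : ℝ := ((Fintype.card (Vn n) : ℕ) : ℝ) with hNdef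
  have hcd0 : 0 ≤ cd (radR M) := sum_nonneg fun x _ => by split_ifs <;> simp
  set K : ℝ := Real.sqrt (N * cd (radR M)) with hK
  set gs : Vn n → Vn n → ℂ := fun s a => f a * f (a + s) with hgs
  have e1 : ∀ h, (Complex.normSq (hat (dl f h) (M h)) : ℂ) =
      ∑ s, conj (ac (gs s) h) * (sg (M h ⬝ᵥ (h + s)) : ℂ) := by
    intro h
    rw [hat_sq, ← sum_shiftC _ h]
    refine sum_congr rfl fun s _ => ?_
    congr 1
    simp only [ac, dl, hgs, map_sum, map_mul, Complex.conj_conj]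
    refine sum_congr rfl fun x _ => ?_
    have : x + (h + s) + h = x + s := by
      rw [show x + (h + s) + h = x + s + (h + h) by abel, Vn_two, add_zero]
    rw [this, add_assoc x h s]; ring
  have e1' : ∀ h, Complex.normSq (hat (dl f h) (M h)) =
      ∑ s, (ac (gs s) h).re * sg (M h ⬝ᵥ (h + s)) := by
    intro h
    have := congrArg Complex.re (e1 h)
    rw [Complex.ofReal_re, Complex.re_sum] at this
    rw [this]
    refine sum_congr rfl fun s _ => ?_
    rw [Complex.re_mul_ofReal, Complex.conj_re]
  have e2 : ∀ s, ∑ h, (ac (gs s) h).re * sg (M h ⬝ᵥ (h + s)) ≤ N * K := by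
    intro s
    have e3 : N * ∑ h, (ac (gs s) h).re * sg (M h ⬝ᵥ (h + s)) =
        ∑ ξ, Complex.normSq (hat (gs s) ξ) * ∑ h, sg (M h ⬝ᵥ (h + s)) * sg (ξ ⬝ᵥ h) := by
      simp only [mul_sum]
      rw [sum_comm]
      refine sum_congr rfl fun h _ => ?_
      have := congrArg Complex.re (hat_inv (gs s) h)
      rw [Complex.re_sum] at this
      have e4 : ((Fintype.card (Vn n) : ℂ) * ac (gs s) h).re = N * (ac (gs s) h).re := by
        rw [show (Fintype.card (Vn n) : ℂ) = ((N : ℝ) : ℂ) by simp [hNdef], Complex.re_ofReal_mul]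
      rw [e4] at this
      rw [← mul_assoc, ← this, sum_mul]
      refine sum_congr rfl fun ξ _ => ?_
      rw [← Complex.ofReal_mul, Complex.ofReal_re]; ring
    have e5 : N * ∑ h, (ac (gs s) h).re * sg (M h ⬝ᵥ (h + s)) ≤ N * (N * K) := by
      rw [e3]
      calc _ ≤ ∑ ξ, Complex.normSq (hat (gs s) ξ) * K := by
            refine sum_le_sum fun ξ _ => mul_le_mul_of_nonneg_left ?_ (Complex.normSq_nonneg _)
            exact Real.le_sqrt_of_sq_le (gauss M s ξ)
        _ = N * (∑ x, Complex.normSq (gs s x)) * K := by rw [← sum_mul, parseval]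
        _ ≤ N * (∑ x : Vn n, (1:ℝ)) * K := by
            gcongr with x _
            rw [Complex.normSq_eq_norm_sq]
            refine pow_le_one₀ (norm_nonneg _) ?_
            rw [hgs, norm_mul]
            exact mul_le_one₀ (hf _) (norm_nonneg _) (hf _)
        _ = _ := by simp [hNdef]; ring
    exact le_of_mul_le_mul_left e5 hN
  have e6 : ∑ h, qf f (h, M h) ≤ K := by
    simp only [qf, ← sum_div, e1']
    rw [div_le_iff₀ (by positivity), sum_comm]
    calc _ ≤ ∑ s : Vn n, N * K := sum_le_sum fun s _ => e2 s
      _ = _ := by simp only [sum_const, card_univ, nsmul_eq_mul]; rw [← hNdef]; ring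
  have e7 : 0 ≤ ∑ h, qf f (h, M h) := sum_nonneg fun h _ => (qf_SD hf).q0 _
  calc _ ≤ K ^ 2 := by gcongr
    _ = _ := Real.sq_sqrt (by positivity)

end stagetwo
end U3I

namespace U3I
set_option linter.unusedSectionVars false

section stagethree
open Finset
open scoped Classical

variable {n : ℕ}

lemma z2_dbl (a : ZMod 2) : a + a = 0 := by revert a; decide

/-- the isotropic part of the radical -/
def radP (M : Vn n →ₗ[ZMod 2] Vn n) : AddSubgroup (Vn n) where
  carrier := {h | h ∈ radR M ∧ M h ⬝ᵥ h = 0}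
  zero_mem' := ⟨(radR M).zero_mem, by simp⟩
  add_mem' := by
    rintro x y ⟨hx, hx0⟩ ⟨hy, hy0⟩
    refine ⟨(radR M).add_mem hx hy, ?_⟩
    have := (mem_radR M x).1 hx y
    simp only [map_add, dotProduct_add, add_dotProduct, hx0, hy0, this]
    simp [z2_dbl]
  neg_mem' := by
    rintro x ⟨hx, hx0⟩
    exact ⟨(radR M).neg_mem hx, by simp [hx0]⟩

lemma mem_radP (M : Vn n →ₗ[ZMod 2] Vn n) (h : Vn n) :
    h ∈ radP M ↔ h ∈ radR M ∧ M h ⬝ᵥ h = 0 := Iff.rfl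

lemma radP_half (M : Vn n →ₗ[ZMod 2] Vn n) : cd (radR M) ≤ 2 * cd (radP M) := by
  have hS : 0 ≤ ∑ h, (if h ∈ radR M then sg (M h ⬝ᵥ h) else 0) := by
    by_cases h : ∀ x ∈ radR M, M x ⬝ᵥ x = 0
    · refine sum_nonneg fun x _ => ?_
      split_ifs with hx
      · rw [h x hx, sg_zero]; norm_num
      · exact le_rfl
    · push Not at h
      obtain ⟨y, hy, hy1⟩ := h
      have hy1' : M y ⬝ᵥ y = 1 := (zmod2 _).resolve_left hy1
      have := sum_shift (fun x => if x ∈ radR M then sg (M x ⬝ᵥ x) else 0) y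
      have e : ∀ x, (if x + y ∈ radR M then sg (M (x + y) ⬝ᵥ (x + y)) else 0) =
          -(if x ∈ radR M then sg (M x ⬝ᵥ x) else 0) := by
        intro x
        have hyx := (mem_radR M y).1 hy x
        have : M (x + y) ⬝ᵥ (x + y) = M x ⬝ᵥ x + 1 := by
          simp only [map_add, dotProduct_add, add_dotProduct, hy1', hyx]
          linear_combination z2_dbl (M x ⬝ᵥ y)
        rw [this, sg_add, sg_one]
        simp only [(radR M).add_mem_cancel_right hy]
        split_ifs <;> ring
      simp only [e, sum_neg_distrib] at this
      linarith
  have : 2 * cd (radP M) = cd (radR M) + ∑ h, (if h ∈ radR M then sg (M h ⬝ᵥ h) else 0) := by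
    simp only [cd, mul_sum]
    rw [← sum_add_distrib]
    refine sum_congr rfl fun h _ => ?_
    by_cases h1 : h ∈ radR M
    · rcases zmod2 (M h ⬝ᵥ h) with h2 | h2
      · simp [mem_radP, h1, h2, sg_zero]; norm_num
      · simp [mem_radP, h1, h2, sg_one]
    · simp [mem_radP, h1]
  linarith

lemma stepC {f : Vn n → ℂ} (hf : ∀ x, ‖f x‖ ≤ 1) (M : Vn n →ₗ[ZMod 2] Vn n) {η : ℝ} (hη : 0 < η)
    (h : η * (Fintype.card (Vn n) : ℝ) ≤ ∑ h, qf f (h, M h)) :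
    η ^ 3 / 2 * (Fintype.card (Vn n) : ℝ) ≤ ∑ h, (if h ∈ radP M then qf f (h, M h) else 0) := by
  have h1 := rad_large hf M
  have h2 := radP_half M
  have hN : (0:ℝ) < ((Fintype.card (Vn n) : ℕ) : ℝ) := by exact_mod_cast Fintype.card_pos
  have h3 : cd (radP M) * ∑ h, qf f (h, M h) ≤ (Fintype.card (Vn n) : ℝ) *
      ∑ h, (if h ∈ radP M then qf f (h, M h) else 0) := by
    calc cd (radP M) * ∑ h, qf f (h, M h)
        = ∑ a : Vn n, ∑ r, (if r ∈ radP M then qf f (r + a, M r + M a) else 0) := by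
          rw [sum_comm, cd, sum_mul]
          refine sum_congr rfl fun r _ => ?_
          split_ifs
          · rw [one_mul, ← sum_shift (fun h => qf f (h, M h)) r]
            refine sum_congr rfl fun a _ => ?_
            rw [← map_add, add_comm]
          · simp
      _ ≤ ∑ a : Vn n, ∑ h, (if h ∈ radP M then qf f (h, M h) else 0) :=
          sum_le_sum fun a _ => graph_pd hf M _ a (M a)
      _ = _ := by simp only [sum_const, card_univ, nsmul_eq_mul]
  generalize (∑ h, qf f (h, M h)) = Γ at *
  generalize (∑ h, (if h ∈ radP M then qf f (h, M h) else 0)) = A at *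
  generalize ((Fintype.card (Vn n) : ℕ) : ℝ) = N at *
  have hΓ : 0 < Γ := lt_of_lt_of_le (by positivity) h
  have h4 : (η * N) ^ 3 ≤ Γ ^ 3 := by gcongr
  have h5 : Γ ^ 3 ≤ 2 * N ^ 2 * A := by
    have : Γ ^ 2 ≤ N * (2 * cd (radP M)) := h1.trans (by gcongr)
    calc Γ ^ 3 = Γ ^ 2 * Γ := by ring
      _ ≤ N * (2 * cd (radP M)) * Γ := by gcongr
      _ = 2 * N * (cd (radP M) * Γ) := by ring
      _ ≤ 2 * N * (N * A) := by gcongr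
      _ = _ := by ring
  have h6 : (2 * N ^ 2) * (η ^ 3 / 2 * N) ≤ (2 * N ^ 2) * A := by
    calc _ = (η * N) ^ 3 := by ring
      _ ≤ _ := h4.trans h5
  exact le_of_mul_le_mul_left h6 (by positivity)

/-- a quadratic form polarising to an alternating form extending `M` on the isotropic radical -/
lemma stepD (M : Vn n →ₗ[ZMod 2] Vn n) :
    ∃ c : Fin n → Fin n → ZMod 2, ∀ r ∈ radP M, ∀ x : Vn n,
      ∑ i, ∑ j, c i j * (x + r) i * (x + r) j =
        ∑ i, ∑ j, c i j * x i * x j + ∑ i, ∑ j, c i j * r i * r j + M r ⬝ᵥ x := by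
  set R : Submodule (ZMod 2) (Vn n) := AddSubgroup.toZModSubmodule 2 (radP M) with hR
  have memR : ∀ x, x ∈ R ↔ x ∈ radP M := fun x => by simp [hR]
  obtain ⟨p, hp⟩ := LinearMap.exists_leftInverse_of_injective R.subtype (by simp)
  set π : Vn n →ₗ[ZMod 2] Vn n := R.subtype ∘ₗ p with hπ
  have hπr : ∀ r ∈ radP M, π r = r := by
    intro r hr
    have := LinearMap.congr_fun hp ⟨r, (memR r).2 hr⟩
    simp only [LinearMap.comp_apply, Submodule.subtype_apply, LinearMap.id_apply] at this
    simp [hπ, this]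
  have hπm : ∀ x, π x ∈ radP M := fun x => (memR _).1 (p x).2
  have hsym : ∀ r ∈ radP M, ∀ k, M r ⬝ᵥ k = M k ⬝ᵥ r := fun r hr => (mem_radR M r).1 hr.1
  let β : Vn n →ₗ[ZMod 2] Vn n →ₗ[ZMod 2] ZMod 2 :=
    LinearMap.mk₂ (ZMod 2) (fun u v => M (π u) ⬝ᵥ v + M (π v) ⬝ᵥ u + M (π u) ⬝ᵥ π v)
      (by intro a b c; simp only [map_add, dotProduct_add, add_dotProduct]; ring)
      (by intro a b c
          simp only [map_smul, dotProduct_smul, smul_dotProduct, smul_eq_mul]; ring)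
      (by intro a b c; simp only [map_add, dotProduct_add, add_dotProduct]; ring)
      (by intro a b c
          simp only [map_smul, dotProduct_smul, smul_dotProduct, smul_eq_mul]; ring)
  have hβ : ∀ u v, β u v = M (π u) ⬝ᵥ v + M (π v) ⬝ᵥ u + M (π u) ⬝ᵥ π v := fun u v => rfl
  have hβs : ∀ u v, β u v = β v u := by
    intro u v
    rw [hβ, hβ, hsym _ (hπm u) (π v)]; ring
  have hβ0 : ∀ u, β u u = 0 := by
    intro u
    rw [hβ, (hπm u).2, z2_dbl, add_zero]
  have hβr : ∀ r ∈ radP M, ∀ v, β r v = M r ⬝ᵥ v := by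
    intro r hr v
    rw [hβ, hπr r hr, hsym r hr (π v), add_assoc, z2_dbl, add_zero]
  set e : Fin n → Vn n := fun i => Pi.single i 1 with he
  have hexp : ∀ u v : Vn n, β u v = ∑ i, ∑ j, β (e i) (e j) * u i * v j := by
    intro u v
    have hu : u = ∑ i, u i • e i := by
      rw [he]; exact pi_eq_sum_univ' u
    have hv : v = ∑ i, v i • e i := by
      rw [he]; exact pi_eq_sum_univ' v
    conv_lhs => rw [hu, hv]
    simp only [map_sum, map_smul, LinearMap.sum_apply, LinearMap.smul_apply, smul_eq_mul, mul_sum]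
    rw [sum_comm]
    refine sum_congr rfl fun i _ => sum_congr rfl fun j _ => by ring
  let c : Fin n → Fin n → ZMod 2 := fun i j => if i < j then β (e i) (e j) else 0
  have hc : ∀ i j, β (e i) (e j) = c i j + c j i := by
    intro i j
    simp only [c]
    rcases lt_trichotomy i j with h | h | h
    · simp [h, h.le, not_lt.2 h.le]
    · subst h; simp [hβ0]
    · simp [h, not_lt.2 h.le, hβs (e i) (e j)]
  refine ⟨c, fun r hr x => ?_⟩
  rw [← hβr r hr x, hexp r x]
  have e1 : ∑ i, ∑ j, β (e i) (e j) * r i * x j =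
      ∑ i, ∑ j, (c i j * r i * x j) + ∑ i, ∑ j, (c i j * x i * r j) := by
    have : ∑ i, ∑ j, (c i j * x i * r j) = ∑ i, ∑ j, (c j i * r i * x j) := by
      rw [sum_comm]
      refine sum_congr rfl fun i _ => sum_congr rfl fun j _ => by ring
    rw [this]
    simp only [← sum_add_distrib]
    refine sum_congr rfl fun i _ => sum_congr rfl fun j _ => by rw [hc]; ring
  rw [e1]
  simp only [← sum_add_distrib]
  refine sum_congr rfl fun i _ => sum_congr rfl fun j _ => ?_
  simp only [Pi.add_apply]; ring

lemma stepE {f : Vn n → ℂ} (hf : ∀ x, ‖f x‖ ≤ 1) (M : Vn n →ₗ[ZMod 2] Vn n) {η : ℝ} (hη : 0 < η)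
    (h : η * (Fintype.card (Vn n) : ℝ) ≤ ∑ h, (if h ∈ radP M then qf f (h, M h) else 0)) :
    ∃ P : Vn n → ZMod 2, IsQuadratic P ∧ η ≤ ‖((Fintype.card (Vn n) : ℂ))⁻¹ *
      ∑ x : Vn n, f x * (-1 : ℂ) ^ (P x).val‖ := by
  have hN : (0:ℝ) < ((Fintype.card (Vn n) : ℕ) : ℝ) := by exact_mod_cast Fintype.card_pos
  obtain ⟨c, hc⟩ := stepD M
  obtain ⟨Q, hQ⟩ : ∃ Q : Vn n → ZMod 2, Q = fun x => ∑ i, ∑ j, c i j * x i * x j := ⟨_, rfl⟩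
  have hQr : ∀ r ∈ radP M, ∀ x, Q (x + r) = Q x + Q r + M r ⬝ᵥ x := by
    rw [hQ]; exact hc
  obtain ⟨g, hg⟩ : ∃ g : Vn n → ℂ, g = fun x => f x * (sg (Q x) : ℂ) := ⟨_, rfl⟩
  have hg1 : ∀ x, ‖g x‖ ≤ 1 := by
    intro x; rw [hg]; simp only [norm_mul, sg_abs, mul_one]; exact hf x
  have hac : ∀ r ∈ radP M, Complex.normSq (ac g r) =
      qf f (r, M r) * ((Fintype.card (Vn n) : ℕ) : ℝ) ^ 2 := by
    intro r hr
    have : ac g r = (sg (Q r) : ℂ) * hat (dl f r) (M r) := by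
      rw [ac, hat, mul_sum]
      refine sum_congr rfl fun x _ => ?_
      simp only [hg, dl, map_mul, Complex.conj_ofReal, hQr r hr x, sg_add, Complex.ofReal_mul]
      have : (sg (Q x) : ℂ) * (sg (Q x) : ℂ) = 1 := by
        rw [← Complex.ofReal_mul, sg_mul_self, Complex.ofReal_one]
      linear_combination (f (x + r) * (sg (Q r) : ℂ) * (sg (M r ⬝ᵥ x) : ℂ) * conj (f x)) * this
    rw [this, map_mul, Complex.normSq_ofReal, sg_mul_self, one_mul, qf]
    field_simp
  have h1 : η * ((Fintype.card (Vn n) : ℕ) : ℝ) ^ 3 ≤ ∑ k, Complex.normSq (ac g k) := by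
    calc η * ((Fintype.card (Vn n) : ℕ) : ℝ) ^ 3
        = (η * ((Fintype.card (Vn n) : ℕ) : ℝ)) * ((Fintype.card (Vn n) : ℕ) : ℝ) ^ 2 := by ring
      _ ≤ (∑ h, (if h ∈ radP M then qf f (h, M h) else 0)) *
          ((Fintype.card (Vn n) : ℕ) : ℝ) ^ 2 := by gcongr
      _ ≤ _ := by
          rw [sum_mul]
          refine sum_le_sum fun k _ => ?_
          split_ifs with hk
          · rw [hac k hk]
          · rw [zero_mul]; exact Complex.normSq_nonneg _
  have h2 := four g
  have h3 : ∑ ξ, Complex.normSq (hat g ξ) ≤ ((Fintype.card (Vn n) : ℕ) : ℝ) ^ 2 := by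
    rw [parseval, sq]
    gcongr
    calc _ ≤ ∑ x : Vn n, (1:ℝ) := by
          refine sum_le_sum fun x _ => ?_
          rw [Complex.normSq_eq_norm_sq]
          exact pow_le_one₀ (norm_nonneg _) (hg1 x)
      _ = _ := by simp only [sum_const, card_univ, nsmul_eq_mul, mul_one]
  obtain ⟨ξ, -, hξ⟩ := Finset.exists_max_image (univ : Finset (Vn n))
    (fun ξ => Complex.normSq (hat g ξ)) ⟨0, mem_univ _⟩
  have h4 : ∑ ζ, Complex.normSq (hat g ζ) ^ 2 ≤
      Complex.normSq (hat g ξ) * ((Fintype.card (Vn n) : ℕ) : ℝ) ^ 2 := by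
    calc _ ≤ ∑ ζ, Complex.normSq (hat g ξ) * Complex.normSq (hat g ζ) := by
          refine sum_le_sum fun ζ _ => ?_
          rw [sq]
          exact mul_le_mul_of_nonneg_right (hξ ζ (mem_univ _)) (Complex.normSq_nonneg _)
      _ ≤ _ := by
          rw [← mul_sum]
          exact mul_le_mul_of_nonneg_left h3 (Complex.normSq_nonneg _)
  refine ⟨fun x => Q x + ξ ⬝ᵥ x, ⟨0, ξ, c, fun x => ?_⟩, ?_⟩
  · simp only [hQ, dotProduct]; ring
  have e : ∑ x : Vn n, f x * (-1 : ℂ) ^ (Q x + ξ ⬝ᵥ x).val = hat g ξ := by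
    rw [hat]
    refine sum_congr rfl fun x _ => ?_
    rw [sg_pow, sg_add, hg, Complex.ofReal_mul]; ring
  rw [e, norm_mul, norm_inv, Complex.norm_natCast]
  have h5 := norm_le_card hg1 ξ
  rw [Complex.normSq_eq_norm_sq] at h4
  have h6 : η * ((Fintype.card (Vn n) : ℕ) : ℝ) ^ 4 ≤
      ‖hat g ξ‖ ^ 2 * ((Fintype.card (Vn n) : ℕ) : ℝ) ^ 2 := by
    refine le_trans ?_ (h2 ▸ h4)
    calc _ = ((Fintype.card (Vn n) : ℕ) : ℝ) * (η * ((Fintype.card (Vn n) : ℕ) : ℝ) ^ 3) := by ring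
      _ ≤ _ := by gcongr
  have h0 := norm_nonneg (hat g ξ)
  clear h2 h4 h1 h3 hac h
  generalize ‖hat g ξ‖ = v at *
  generalize ((Fintype.card (Vn n) : ℕ) : ℝ) = N at *
  rw [← div_eq_inv_mul, le_div_iff₀ hN]
  have h7 : (N ^ 3) * (η * N) ≤ N ^ 3 * v := by
    calc _ = η * N ^ 4 := by ring
      _ ≤ v ^ 2 * N ^ 2 := h6
      _ = v * v * N ^ 2 := by ring
      _ ≤ N * v * N ^ 2 := by gcongr
      _ = _ := by ring
  exact le_of_mul_le_mul_left h7 (by positivity)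

lemma final_step {f : Vn n → ℂ} (hf : ∀ x, ‖f x‖ ≤ 1) {δ : ℝ} (hδ : 0 < δ)
    (h : δ ≤ (u3Pow8 f).re) :
    ∃ P : Vn n → ZMod 2, IsQuadratic P ∧ (c1 * δ ^ 7350) ^ 9 / 2 ≤
      ‖((Fintype.card (Vn n) : ℂ))⁻¹ * ∑ x : Vn n, f x * (-1 : ℂ) ^ (P x).val‖ := by
  have hN : (0:ℝ) < ((Fintype.card (Vn n) : ℕ) : ℝ) := by exact_mod_cast Fintype.card_pos
  have hq := qf_SD hf
  have h2 : δ * ((Fintype.card (Vn n) : ℕ) : ℝ) ≤ ∑ t, qf f t ^ 2 := by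
    rw [qf_u3, mul_comm]; gcongr
  have hδ1 : δ ≤ 1 := by
    have : ∑ t, qf f t ^ 2 ≤ ∑ t, qf f t := by
      refine sum_le_sum fun t _ => ?_
      nlinarith [hq.q0 t, hq.q1 t]
    have h3 : δ * ((Fintype.card (Vn n) : ℕ) : ℝ) ≤ 1 * ((Fintype.card (Vn n) : ℕ) : ℝ) := by
      rw [one_mul]; exact h2.trans (this.trans hq.qsum)
    exact le_of_mul_le_mul_right h3 hN
  obtain ⟨H, hH1, hH2⟩ := stage1 (fun x : Vn n × Vn n => by
    ext1 <;> exact Vn_two _) hq hδ hδ1 h2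
  have hγ : 0 < c1 * δ ^ 7350 := mul_pos c1_pos (pow_pos hδ _)
  generalize c1 * δ ^ 7350 = γ at *
  obtain ⟨M, hM⟩ := exists_M hf hγ H hH1 hH2
  have h5 := stepC hf M (pow_pos hγ 3) hM
  rw [← pow_mul] at h5
  exact stepE hf M (by positivity) h5

end stagethree
end U3I

/-- **Polynomial inverse theorem for the Gowers `U³` norm over `F_2^n`.** -/
theorem u3_inverse :
    ∃ C₅ c : ℝ, 0 < C₅ ∧ 0 < c ∧
      ∀ (n : ℕ) (K : ℝ), 0 < K → ∀ f : (Fin n → ZMod 2) → ℂ,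
        (∀ x, ‖f x‖ ≤ 1) →
        (1 : ℝ) / K ≤ u3Norm f →
        ∃ P : (Fin n → ZMod 2) → ZMod 2, IsQuadratic P ∧
          c * K ^ (-C₅) ≤
            ‖(((Fintype.card (Fin n → ZMod 2) : ℂ))⁻¹ *
              ∑ x : Fin n → ZMod 2, f x * (-1 : ℂ) ^ (P x).val)‖ := by
  obtain ⟨m, hm⟩ : ∃ m : ℕ, m = 7350 := ⟨_, rfl⟩
  have hmpos : 0 < m := by omega
  refine ⟨((8 * m * 9 : ℕ) : ℝ), U3I.c1 ^ 9 / 2, by positivity,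
    div_pos (pow_pos U3I.c1_pos _) two_pos, ?_⟩
  intro n K hK f hf hu
  have hre0 : 0 ≤ (u3Pow8 f).re := by
    have h1 := U3I.qf_u3 f
    have hN : (0:ℝ) < ((Fintype.card (U3I.Vn n) : ℕ) : ℝ) := by exact_mod_cast Fintype.card_pos
    have h2 : 0 ≤ ∑ t, U3I.qf f t ^ 2 := Finset.sum_nonneg fun t _ => sq_nonneg _
    rw [h1] at h2
    exact nonneg_of_mul_nonneg_right h2 hN
  have hδ : ((1 : ℝ) / K) ^ 8 ≤ (u3Pow8 f).re := by
    calc ((1 : ℝ) / K) ^ 8 ≤ u3Norm f ^ 8 := by gcongr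
      _ = (u3Pow8 f).re := by
        rw [u3Norm, ← Real.rpow_natCast, ← Real.rpow_mul hre0]
        norm_num
  obtain ⟨P, hP, h⟩ := U3I.final_step hf (by positivity) hδ
  refine ⟨P, hP, le_trans (le_of_eq ?_) h⟩
  rw [← hm, Real.rpow_neg hK.le, Real.rpow_natCast, one_div, inv_pow, inv_pow, mul_pow, inv_pow,
    ← pow_mul, ← pow_mul, div_mul_eq_mul_div, mul_assoc]

end
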